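/- arXiv:2412.00655 — 3 statements merged into one kernel-verified Lean document; each statement's English description precedes it below -/
import Mathlib

section
/- Suppose each h_i ∈ H (i = 1,…,n) is continuous and convex on [0,1]. Let 𝒳 = L^+ (nonnegative bounded random variables) and let X ∈ 𝒳 be such that there exists a random variable U uniform on [0,1] independent of X. Then □_{i=1}^n ρ_{h_i}(X) = ⊟_{i=1}^n ρ_{h_i}(X) = ρ_g(X), where g = □_{i=1}^n h_i is the inf-convolution of the functions h_1,…,h_n and ρ_g(X) = ∫_0^∞ g(P(X ≥ x)) dx. -/
open MeasureTheory ProbabilityTheory Set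

noncomputable section

variable {Ω : Type*} [MeasurableSpace Ω]

/-- An atomless measure: every set of positive measure has a measurable subset of
strictly smaller positive measure. -/
def Atomless (P : Measure Ω) : Prop :=
  ∀ A : Set Ω, MeasurableSet A → 0 < P A →
    ∃ B, B ⊆ A ∧ MeasurableSet B ∧ 0 < P B ∧ P B < P A

/-- Membership in the class `H` of distortion functions: increasing on `[0,1]`,
`h 0 = 0` and `h 1 = 1`. -/
def MemH (h : ℝ → ℝ) : Prop :=
  MonotoneOn h (Icc 0 1) ∧ h 0 = 0 ∧ h 1 = 1

/-- Two random variables are counter-monotonic. -/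
def CounterMonotone (P : Measure Ω) (X Y : Ω → ℝ) : Prop :=
  ∀ᵐ p ∂(P.prod P), (X p.1 - X p.2) * (Y p.1 - Y p.2) ≤ 0

/-- Two random variables are comonotonic. -/
def Comonotone (P : Measure Ω) (X Y : Ω → ℝ) : Prop :=
  ∀ᵐ p ∂(P.prod P), 0 ≤ (X p.1 - X p.2) * (Y p.1 - Y p.2)

/-- A random vector is pairwise counter-monotonic. -/
def PairwiseCtr (P : Measure Ω) {n : ℕ} (Xs : Fin n → Ω → ℝ) : Prop :=
  ∀ i j, i ≠ j → CounterMonotone P (Xs i) (Xs j)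

/-- A random vector is (pairwise) comonotonic. -/
def PairwiseCom (P : Measure Ω) {n : ℕ} (Xs : Fin n → Ω → ℝ) : Prop :=
  ∀ i j, i ≠ j → Comonotone P (Xs i) (Xs j)

/-- Nonnegative bounded measurable random variables (`L^+`). -/
def MemLpos (X : Ω → ℝ) : Prop :=
  Measurable X ∧ (∀ ω, 0 ≤ X ω) ∧ ∃ M : ℝ, ∀ ω, X ω ≤ M

/-- The distortion riskmetric of a nonnegative random variable:
`ρ_g(X) = ∫_0^∞ g(P(X ≥ x)) dx`. -/
def distortionPos (P : Measure Ω) (g : ℝ → ℝ) (X : Ω → ℝ) : ℝ :=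
  ∫ x in Ioi (0:ℝ), g ((P {ω | x ≤ X ω}).toReal)

/-- `Xs` is an allocation of `X` within `L^+`. -/
def IsAllocPos (P : Measure Ω) {n : ℕ} (X : Ω → ℝ) (Xs : Fin n → Ω → ℝ) : Prop :=
  (∀ i, MemLpos (Xs i)) ∧ (∀ᵐ ω ∂P, ∑ i, Xs i ω = X ω)

/-- The inf-convolution `□_{i=1}^n ρ_{h_i}(X)` over allocations in `L^+`. -/
def infConvPos (P : Measure Ω) {n : ℕ} (h : Fin n → ℝ → ℝ) (X : Ω → ℝ) : EReal :=
  sInf {y : EReal | ∃ Xs : Fin n → Ω → ℝ, IsAllocPos P X Xs ∧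
    y = ((∑ i, distortionPos P (h i) (Xs i) : ℝ) : EReal)}

/-- The counter-monotonic inf-convolution `⊟_{i=1}^n ρ_{h_i}(X)` over allocations in `L^+`. -/
def ctrInfConvPos (P : Measure Ω) {n : ℕ} (h : Fin n → ℝ → ℝ) (X : Ω → ℝ) : EReal :=
  sInf {y : EReal | ∃ Xs : Fin n → Ω → ℝ, IsAllocPos P X Xs ∧ PairwiseCtr P Xs ∧
    y = ((∑ i, distortionPos P (h i) (Xs i) : ℝ) : EReal)}

/-- The inf-convolution of functions `h_1, …, h_n` on `[0,1]`:
`(□ h_i)(x) = inf { Σ h_i(x_i) : x_i ∈ [0,1], Σ x_i = x }`. -/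
def funInfConv {n : ℕ} (h : Fin n → ℝ → ℝ) (x : ℝ) : ℝ :=
  sInf {y : ℝ | ∃ t : Fin n → ℝ, (∀ i, t i ∈ Icc (0:ℝ) 1) ∧ (∑ i, t i) = x ∧
    y = ∑ i, h i (t i)}

/-- An optimal way of writing `x` as `∑ i, t i` in the problem defining `funInfConv h x`. -/
def IsOptSplit {n : ℕ} (h : Fin n → ℝ → ℝ) (x : ℝ) (t : Fin n → ℝ) : Prop :=
  (∀ i, t i ∈ Icc (0:ℝ) 1) ∧ ∑ i, t i = x ∧
    ∀ s : Fin n → ℝ, (∀ i, s i ∈ Icc (0:ℝ) 1) → ∑ i, s i = x →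
      ∑ i, h i (t i) ≤ ∑ i, h i (s i)

lemma MemH.nonneg {h : ℝ → ℝ} (hh : MemH h) {x : ℝ} (hx : x ∈ Icc (0:ℝ) 1) : 0 ≤ h x := by
  rw [← hh.2.1]
  exact hh.1 ⟨le_rfl, zero_le_one⟩ hx hx.1

lemma funInfConv_le {n : ℕ} {h : Fin n → ℝ → ℝ} (hH : ∀ i, MemH (h i)) {t : Fin n → ℝ}
    (ht : ∀ i, t i ∈ Icc (0:ℝ) 1) : funInfConv h (∑ i, t i) ≤ ∑ i, h i (t i) := by
  refine csInf_le ⟨0, ?_⟩ ⟨t, ht, rfl, rfl⟩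
  rintro y ⟨s, hs, -, rfl⟩
  exact Finset.sum_nonneg fun i _ => (hH i).nonneg (hs i)

lemma IsOptSplit.funInfConv_eq {n : ℕ} {h : Fin n → ℝ → ℝ} (hH : ∀ i, MemH (h i)) {x : ℝ}
    {t : Fin n → ℝ} (ht : IsOptSplit h x t) : funInfConv h x = ∑ i, h i (t i) := by
  apply le_antisymm
  · rw [← ht.2.1]
    exact funInfConv_le hH ht.1
  · refine le_csInf ⟨_, t, ht.1, ht.2.1, rfl⟩ ?_
    rintro y ⟨s, hs, hsx, rfl⟩
    exact ht.2.2 s hs hsx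

lemma exists_isOptSplit {n : ℕ} (hn : 0 < n) {h : Fin n → ℝ → ℝ}
    (hcont : ∀ i, ContinuousOn (h i) (Icc 0 1)) {x : ℝ} (hx : x ∈ Icc (0:ℝ) 1) :
    ∃ t, IsOptSplit h x t := by
  let S : Set (Fin n → ℝ) := (Set.univ.pi fun _ => Icc (0:ℝ) 1) ∩ {t | ∑ i, t i = x}
  have hS : IsCompact S :=
    (isCompact_univ_pi fun _ => isCompact_Icc).inter_right
      (isClosed_eq (by fun_prop) continuous_const)
  have hne : S.Nonempty := by
    refine ⟨Pi.single ⟨0, hn⟩ x, ?_, by simp⟩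
    intro i _
    by_cases hi : i = ⟨0, hn⟩
    · subst hi; simpa using hx
    · simp [hi]
  have hc : ContinuousOn (fun t : Fin n → ℝ => ∑ i, h i (t i)) S :=
    continuousOn_finsetSum _ fun i _ =>
      (hcont i).comp (continuous_apply i).continuousOn fun t ht => ht.1 i (mem_univ i)
  obtain ⟨t, ht, hmin⟩ := hS.exists_isMinOn hne hc
  exact ⟨t, fun i => ht.1 i (mem_univ i), ht.2, fun s hs hsx => hmin ⟨fun i _ => hs i, hsx⟩⟩

/-- Moving two points towards each other decreases the sum of the values of a convex function. -/
lemma ConvexOn.add_le_of_combo {h : ℝ → ℝ} {S : Set ℝ} (hconv : ConvexOn ℝ S h) {a b θ : ℝ}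
    (ha : a ∈ S) (hb : b ∈ S) (h0 : 0 ≤ θ) (h1 : θ ≤ 1) :
    h (b - θ * (b - a)) + h (a + θ * (b - a)) ≤ h b + h a := by
  have e1 := hconv.2 ha hb h0 (sub_nonneg.2 h1) (by ring)
  have e2 := hconv.2 ha hb (sub_nonneg.2 h1) h0 (by ring)
  simp only [smul_eq_mul] at e1 e2
  rw [show b - θ * (b - a) = θ * a + (1 - θ) * b by ring,
    show a + θ * (b - a) = (1 - θ) * a + θ * b by ring]
  linarith

/-- Optimal splits can be chosen increasingly. -/
lemma IsOptSplit.exists_ge {n : ℕ} {h : Fin n → ℝ → ℝ}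
    (hconv : ∀ i, ConvexOn ℝ (Icc 0 1) (h i)) {p q : ℝ} (hpq : p ≤ q) {t r : Fin n → ℝ}
    (ht : IsOptSplit h p t) (hr : IsOptSplit h q r) :
    ∃ s, IsOptSplit h q s ∧ ∀ i, t i ≤ s i := by
  set α := ∑ i, max (t i - r i) 0
  set β := ∑ i, max (r i - t i) 0
  have hα : 0 ≤ α := Finset.sum_nonneg fun i _ => le_max_right _ _
  have hβ : 0 ≤ β := Finset.sum_nonneg fun i _ => le_max_right _ _
  have hαβ : β - α = q - p := by
    rw [← ht.2.1, ← hr.2.1, ← Finset.sum_sub_distrib, ← Finset.sum_sub_distrib]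
    refine Finset.sum_congr rfl fun i _ => ?_
    rcases le_total (r i) (t i) with hle | hle
    · rw [max_eq_right (sub_nonpos.2 hle), max_eq_left (sub_nonneg.2 hle)]; ring
    · rw [max_eq_left (sub_nonneg.2 hle), max_eq_right (sub_nonpos.2 hle)]; ring
  obtain ⟨θ, h0, h1, hθ⟩ : ∃ θ : ℝ, 0 ≤ θ ∧ θ ≤ 1 ∧ θ * β = α := by
    rcases hβ.eq_or_lt with hz | hpos
    · exact ⟨0, le_rfl, zero_le_one, by linarith⟩
    · exact ⟨α / β, by positivity, (div_le_one hpos).2 (by linarith),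
        div_mul_cancel₀ _ hpos.ne'⟩
  let s : Fin n → ℝ := fun i => max (r i) (t i) - θ * max (r i - t i) 0
  let u : Fin n → ℝ := fun i => min (r i) (t i) + θ * max (r i - t i) 0
  have hs_le : ∀ i, r i ≤ t i → s i = t i ∧ u i = r i := fun i hle => by
    simp [s, u, hle]
  have hs_ge : ∀ i, t i ≤ r i → s i = r i - θ * (r i - t i) ∧ u i = t i + θ * (r i - t i) :=
    fun i hle => by simp [s, u, hle]
  have hmem : ∀ i, t i ≤ s i ∧ s i ∈ Icc (0:ℝ) 1 ∧ u i ∈ Icc (0:ℝ) 1 := by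
    intro i
    have ti := ht.1 i
    have ri := hr.1 i
    rcases le_total (r i) (t i) with hle | hle
    · rw [(hs_le i hle).1, (hs_le i hle).2]
      exact ⟨le_rfl, ti, ri⟩
    · rw [(hs_ge i hle).1, (hs_ge i hle).2]
      have e1 : 0 ≤ θ * (r i - t i) := mul_nonneg h0 (sub_nonneg.2 hle)
      have e2 : θ * (r i - t i) ≤ r i - t i := mul_le_of_le_one_left (sub_nonneg.2 hle) h1
      exact ⟨by linarith, ⟨by linarith [ti.1], by linarith [ri.2]⟩,
        ⟨by linarith [ti.1], by linarith [ri.2]⟩⟩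
  have hsum_s : ∑ i, s i = q := by
    have e : ∑ i, s i = ∑ i, (r i + max (t i - r i) 0) - θ * β := by
      rw [Finset.mul_sum, ← Finset.sum_sub_distrib]
      refine Finset.sum_congr rfl fun i _ => ?_
      simp only [s]
      rw [← max_add_add_left]
      simp [max_comm]
    rw [e, Finset.sum_add_distrib, hr.2.1, hθ]
    ring
  have hsum_u : ∑ i, u i = p := by
    have e : ∑ i, u i + ∑ i, s i = ∑ i, r i + ∑ i, t i := by
      rw [← Finset.sum_add_distrib, ← Finset.sum_add_distrib]
      refine Finset.sum_congr rfl fun i _ => ?_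
      simp only [s, u]
      linarith [min_add_max (r i) (t i)]
    linarith [ht.2.1, hr.2.1]
  have hval : ∑ i, h i (s i) + ∑ i, h i (u i) ≤ ∑ i, h i (r i) + ∑ i, h i (t i) := by
    rw [← Finset.sum_add_distrib, ← Finset.sum_add_distrib]
    refine Finset.sum_le_sum fun i _ => ?_
    rcases le_total (r i) (t i) with hle | hle
    · rw [(hs_le i hle).1, (hs_le i hle).2, add_comm]
    · rw [(hs_ge i hle).1, (hs_ge i hle).2]
      exact (hconv i).add_le_of_combo (ht.1 i) (hr.1 i) h0 h1
  have hu := ht.2.2 u (fun i => (hmem i).2.2) hsum_u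
  refine ⟨s, ⟨fun i => (hmem i).2.1, hsum_s, fun v hv hvq => ?_⟩, fun i => (hmem i).1⟩
  linarith [hr.2.2 v hv hvq]

lemma exists_monotone_isOptSplit {n : ℕ} (hn : 0 < n) {h : Fin n → ℝ → ℝ}
    (hcont : ∀ i, ContinuousOn (h i) (Icc 0 1)) (hconv : ∀ i, ConvexOn ℝ (Icc 0 1) (h i))
    {b : ℕ → ℝ} (hb : Monotone b) (hb01 : ∀ d, b d ∈ Icc (0:ℝ) 1) :
    ∃ s : ℕ → Fin n → ℝ, (∀ d, IsOptSplit h (b d) (s d)) ∧ ∀ d i, s d i ≤ s (d + 1) i := by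
  obtain ⟨s₀, hs₀⟩ := exists_isOptSplit hn hcont (hb01 0)
  have step : ∀ d (t : {t // IsOptSplit h (b d) t}),
      ∃ s : {t // IsOptSplit h (b (d + 1)) t}, ∀ i, t.1 i ≤ s.1 i := by
    rintro d ⟨t, ht⟩
    obtain ⟨r, hr⟩ := exists_isOptSplit hn hcont (hb01 (d + 1))
    obtain ⟨s, hs, hts⟩ := ht.exists_ge hconv (hb d.le_succ) hr
    exact ⟨⟨s, hs⟩, hts⟩
  choose f hf using step
  let s : ∀ d, {t // IsOptSplit h (b d) t} := fun d => Nat.rec ⟨s₀, hs₀⟩ f d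
  exact ⟨fun d => (s d).1, fun d => (s d).2, fun d i => hf d (s d) i⟩

lemma funInfConv_monotoneOn {n : ℕ} (hn : 0 < n) {h : Fin n → ℝ → ℝ} (hH : ∀ i, MemH (h i))
    (hcont : ∀ i, ContinuousOn (h i) (Icc 0 1)) (hconv : ∀ i, ConvexOn ℝ (Icc 0 1) (h i)) :
    MonotoneOn (funInfConv h) (Icc 0 1) := by
  intro p hp q hq hpq
  obtain ⟨t, ht⟩ := exists_isOptSplit hn hcont hp
  obtain ⟨r, hr⟩ := exists_isOptSplit hn hcont hq
  obtain ⟨s, hs, hts⟩ := ht.exists_ge hconv hpq hr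
  rw [ht.funInfConv_eq hH, hs.funInfConv_eq hH]
  exact Finset.sum_le_sum fun i _ => (hH i).1 (ht.1 i) (hs.1 i) (hts i)

lemma funInfConv_zero {n : ℕ} (hn : 0 < n) {h : Fin n → ℝ → ℝ} (hH : ∀ i, MemH (h i))
    (hcont : ∀ i, ContinuousOn (h i) (Icc 0 1)) : funInfConv h 0 = 0 := by
  obtain ⟨t, ht⟩ := exists_isOptSplit hn hcont (x := 0) ⟨le_rfl, zero_le_one⟩
  have h0 : ∀ i, t i = 0 := fun i =>
    (Finset.sum_eq_zero_iff_of_nonneg fun i _ => (ht.1 i).1).1 ht.2.1 i (Finset.mem_univ i)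
  rw [ht.funInfConv_eq hH]
  exact Finset.sum_eq_zero fun i _ => by rw [h0 i, (hH i).2.1]

lemma funInfConv_one_le {n : ℕ} (hn : 0 < n) {h : Fin n → ℝ → ℝ} (hH : ∀ i, MemH (h i)) :
    funInfConv h 1 ≤ 1 := by
  let t : Fin n → ℝ := Pi.single ⟨0, hn⟩ 1
  have ht : ∀ i, t i ∈ Icc (0:ℝ) 1 := fun i => by
    by_cases hi : i = ⟨0, hn⟩
    · subst hi; simp [t]
    · simp [t, hi]
  have hsum : ∑ i, h i (t i) = 1 := by
    rw [Finset.sum_eq_single ⟨0, hn⟩ (fun i _ hi => ?_) (by simp)]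
    · simp [t, (hH _).2.2]
    · simp [t, hi, (hH i).2.1]
  simpa [hsum, t] using funInfConv_le hH ht

/-- Two-sided Riemann sum estimate for the integral of a decreasing function. -/
lemma Antitone.riemann_bounds {G : ℝ → ℝ} (hG : Antitone G) {δ : ℝ} (hδ : 0 < δ) (N : ℕ)
    (hz : ∀ x, N * δ < x → G x = 0) :
    δ * ∑ k ∈ Finset.range N, G ((k + 1 : ℕ) * δ) ≤ ∫ x in Ioi (0:ℝ), G x ∧
    ∫ x in Ioi (0:ℝ), G x ≤ δ * (G 0 + ∑ k ∈ Finset.range N, G ((k + 1 : ℕ) * δ)) := by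
  have hc : (0:ℝ) ≤ N * δ := by positivity
  have hI : ∫ x in Ioi (0:ℝ), G x = δ * ∫ x in (0:ℝ)..(0 + N), G (x * δ) := by
    rw [intervalIntegral.integral_comp_mul_right _ hδ.ne', zero_mul, zero_add, smul_eq_mul,
      mul_inv_cancel_left₀ hδ.ne', intervalIntegral.integral_of_le hc]
    refine setIntegral_eq_of_subset_of_forall_sdiff_eq_zero measurableSet_Ioi
      Ioc_subset_Ioi_self fun x hx => hz x ?_
    by_contra hle
    exact hx.2 ⟨hx.1, not_lt.1 hle⟩
  have hA : Antitone fun x => G (x * δ) := fun x y hxy =>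
    hG (mul_le_mul_of_nonneg_right hxy hδ.le)
  have hN : 0 ≤ G (N * δ) := by
    rw [← hz (N * δ + 1) (by linarith)]
    exact hG (by linarith)
  have h1 := (hA.antitoneOn (Icc (0:ℝ) (0 + N))).sum_le_integral
  have h2 := (hA.antitoneOn (Icc (0:ℝ) (0 + N))).integral_le_sum
  simp only [zero_add] at h1 h2
  rw [hI, zero_add]
  refine ⟨mul_le_mul_of_nonneg_left h1 hδ.le, mul_le_mul_of_nonneg_left (h2.trans ?_) hδ.le⟩
  have e1 := Finset.sum_range_succ (fun k : ℕ => G (k * δ)) N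
  have e2 := Finset.sum_range_succ' (fun k : ℕ => G (k * δ)) N
  simp only [Nat.cast_zero, zero_mul] at e2
  linarith

lemma distortionPos_riemann_bounds (P : Measure Ω) [IsProbabilityMeasure P] {g : ℝ → ℝ}
    (hg : MonotoneOn g (Icc 0 1)) (hg0 : g 0 = 0) {X : Ω → ℝ} {δ : ℝ} (hδ : 0 < δ) (N : ℕ)
    (hX : ∀ ω, X ω ≤ N * δ) :
    δ * ∑ k ∈ Finset.range N, g (P.real {ω | (k + 1 : ℕ) * δ ≤ X ω}) ≤ distortionPos P g X ∧
    distortionPos P g X ≤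
      δ * (g 1 + ∑ k ∈ Finset.range N, g (P.real {ω | (k + 1 : ℕ) * δ ≤ X ω})) := by
  have hmem : ∀ A : Set Ω, P.real A ∈ Icc (0:ℝ) 1 := fun A =>
    ⟨measureReal_nonneg, measureReal_le_one⟩
  have hG : Antitone fun x : ℝ => g (P.real {ω | x ≤ X ω}) := fun x y hxy =>
    hg (hmem _) (hmem _) (measureReal_mono fun ω (hω : y ≤ X ω) => hxy.trans hω)
  obtain ⟨h1, h2⟩ := hG.riemann_bounds hδ N fun x hx => by
    have : {ω | x ≤ X ω} = ∅ := eq_empty_of_forall_notMem fun ω (hω : x ≤ X ω) =>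
      absurd (hX ω) (by linarith)
    rw [this, measureReal_empty, hg0]
  refine ⟨h1, h2.trans (mul_le_mul_of_nonneg_left ?_ hδ.le)⟩
  have := hg (hmem {ω | 0 ≤ X ω}) ⟨zero_le_one, le_rfl⟩ (hmem _).2
  linarith

lemma ConvexOn.increment_le_slope_mul {h : ℝ → ℝ} {S : Set ℝ} (hconv : ConvexOn ℝ S h)
    {s s' a a' : ℝ} (hs : s ∈ S) (hs' : s' ∈ S) (ha : a ∈ S) (ha' : a' ∈ S)
    (hss : s' ≤ s) (hsa' : s' ≤ a') (hinc : s - s' ≤ a - a') :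
    h s - h s' ≤ (h a - h a') / (a - a') * (s - s') := by
  rcases hss.eq_or_lt with rfl | hlt
  · simp
  rw [← div_le_iff₀ (sub_pos.2 hlt)]
  calc (h s - h s') / (s - s') ≤ (h a - h s') / (a - s') :=
        hconv.secant_mono hs' hs ha hlt.ne' (by linarith : s' < a).ne' (by linarith)
    _ = (h s' - h a) / (s' - a) := by rw [← neg_div_neg_eq, neg_sub, neg_sub]
    _ ≤ (h a' - h a) / (a' - a) :=
        hconv.secant_mono ha hs' ha' (by linarith : s' < a).ne (by linarith : a' < a).ne hsa'
    _ = (h a - h a') / (a - a') := by rw [← neg_div_neg_eq, neg_sub, neg_sub]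

lemma inter_le_eq_union_inter_eq {α : Type*} (A : Set α) (K : α → ℕ) (k : ℕ) :
    A ∩ {ω | k ≤ K ω} = A ∩ {ω | k + 1 ≤ K ω} ∪ A ∩ {ω | K ω = k} := by
  ext ω
  simp only [mem_inter_iff, mem_union, mem_ofPred_eq, ← and_or_left]
  exact and_congr_right fun _ => by omega

lemma disjoint_inter_le_inter_eq {α : Type*} (A : Set α) (K : α → ℕ) (k : ℕ) :
    Disjoint (A ∩ {ω | k + 1 ≤ K ω}) (A ∩ {ω | K ω = k}) := by
  rw [Set.disjoint_left]
  rintro ω ⟨-, h1⟩ ⟨-, h2⟩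
  simp only [mem_ofPred_eq] at h1 h2
  omega

lemma measurableSet_nat_eq {K : Ω → ℕ} (hK : Measurable K) (k : ℕ) :
    MeasurableSet {ω | K ω = k} := hK (measurableSet_singleton k)

lemma measureReal_inter_tail_succ (P : Measure Ω) [IsFiniteMeasure P] {K : Ω → ℕ}
    (hK : Measurable K) {A : Set Ω} (hA : MeasurableSet A) (k : ℕ) :
    P.real (A ∩ {ω | k ≤ K ω}) =
      P.real (A ∩ {ω | k + 1 ≤ K ω}) + P.real (A ∩ {ω | K ω = k}) := by
  rw [inter_le_eq_union_inter_eq, measureReal_union (disjoint_inter_le_inter_eq A K k)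
    (hA.inter (measurableSet_nat_eq hK k))]

lemma integrable_comp_bounded_nat (P : Measure Ω) [IsFiniteMeasure P] (φ : ℕ → ℝ) {K : Ω → ℕ}
    (hK : Measurable K) {N : ℕ} (hN : ∀ ω, K ω ≤ N) : Integrable (fun ω => φ (K ω)) P := by
  refine Integrable.of_bound
    ((measurable_of_countable φ).comp hK).aestronglyMeasurable
    (∑ k ∈ Finset.range (N + 1), ‖φ k‖) (ae_of_all _ fun ω => ?_)
  exact Finset.single_le_sum (f := fun k => ‖φ k‖) (fun _ _ => norm_nonneg _)
    (Finset.mem_range.2 (Nat.lt_succ_of_le (hN ω)))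

lemma setIntegral_inter_tail_succ (P : Measure Ω) [IsFiniteMeasure P] (φ : ℕ → ℝ) {K : Ω → ℕ}
    (hK : Measurable K) {N : ℕ} (hN : ∀ ω, K ω ≤ N) {A : Set Ω} (hA : MeasurableSet A) (k : ℕ) :
    ∫ ω in A ∩ {ω | k ≤ K ω}, φ (K ω) ∂P =
      ∫ ω in A ∩ {ω | k + 1 ≤ K ω}, φ (K ω) ∂P + φ k * P.real (A ∩ {ω | K ω = k}) := by
  have hint := integrable_comp_bounded_nat P φ hK hN
  have hmeas := hA.inter (measurableSet_nat_eq hK k)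
  rw [inter_le_eq_union_inter_eq, setIntegral_union (disjoint_inter_le_inter_eq A K k) hmeas
    hint.integrableOn hint.integrableOn]
  congr 1
  rw [setIntegral_congr_fun (g := fun _ => φ k) hmeas fun ω hω => congrArg φ hω.2,
    setIntegral_const, smul_eq_mul, mul_comm]

/-- A density `φ ∘ K` of a measure that dominates the distorted
probability `h ∘ P` and agrees with it on the upper level sets of `K`. -/
lemma exists_distortion_density (P : Measure Ω) [IsProbabilityMeasure P] {h : ℝ → ℝ}
    (hH : MemH h) (hconv : ConvexOn ℝ (Icc 0 1) h) {K : Ω → ℕ} (hK : Measurable K) {N : ℕ}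
    (hN : ∀ ω, K ω ≤ N) :
    ∃ φ : ℕ → ℝ, (∀ k, 0 ≤ φ k) ∧
      (∀ k, ∫ ω in {ω | k ≤ K ω}, φ (K ω) ∂P = h (P.real {ω | k ≤ K ω})) ∧
      ∀ A, MeasurableSet A → h (P.real A) ≤ ∫ ω in A, φ (K ω) ∂P := by
  let a : ℕ → ℝ := fun k => P.real {ω | k ≤ K ω}
  have hmem : ∀ A : Set Ω, P.real A ∈ Icc (0:ℝ) 1 := fun A =>
    ⟨measureReal_nonneg, measureReal_le_one⟩
  have ha : ∀ k, a (k + 1) ≤ a k := fun k =>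
    measureReal_mono fun ω (hω : k + 1 ≤ K ω) => (Nat.le_succ k).trans hω
  have htail : ∀ k, a k = a (k + 1) + P.real {ω | K ω = k} := fun k => by
    simpa only [univ_inter] using measureReal_inter_tail_succ P hK MeasurableSet.univ k
  have hempty : ∀ k, N + 1 ≤ k → {ω | k ≤ K ω} = ∅ := fun k hk =>
    eq_empty_of_forall_notMem fun ω (hω : k ≤ K ω) => by have := hN ω; omega
  let φ : ℕ → ℝ := fun k => (h (a k) - h (a (k + 1))) / (a k - a (k + 1))
  refine ⟨φ, fun k => div_nonneg (sub_nonneg.2 (hH.1 (hmem _) (hmem _) (ha k)))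
    (sub_nonneg.2 (ha k)), fun k => ?_, fun A hA => ?_⟩
  · rcases le_total k (N + 1) with hk | hk
    · refine Nat.decreasingInduction
        (motive := fun k _ => ∫ ω in {ω | k ≤ K ω}, φ (K ω) ∂P = h (a k))
        (fun k _ ih => ?_) ?_ hk
      · have e := setIntegral_inter_tail_succ P φ hK hN MeasurableSet.univ k
        simp only [univ_inter] at e
        rw [e, ih, show P.real {ω | K ω = k} = a k - a (k + 1) by linarith [htail k]]
        simp only [φ]
        rcases (ha k).eq_or_lt with heq | hlt
        · simp [heq]
        · rw [div_mul_cancel₀ _ (sub_pos.2 hlt).ne']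
          ring
      · simp only [a]
        rw [hempty (N + 1) le_rfl]
        simp [hH.2.1]
    · simp [hempty k hk, hH.2.1]
  · have key : h (P.real (A ∩ {ω | 0 ≤ K ω})) ≤ ∫ ω in A ∩ {ω | 0 ≤ K ω}, φ (K ω) ∂P := by
      refine Nat.decreasingInduction
        (motive := fun k _ =>
          h (P.real (A ∩ {ω | k ≤ K ω})) ≤ ∫ ω in A ∩ {ω | k ≤ K ω}, φ (K ω) ∂P)
        (fun k _ ih => ?_) ?_ (Nat.zero_le (N + 1))
      · have hA1 := measureReal_inter_tail_succ P hK hA k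
        have hA2 : P.real (A ∩ {ω | K ω = k}) ≤ P.real {ω | K ω = k} :=
          measureReal_mono inter_subset_right
        have hA3 : P.real (A ∩ {ω | k + 1 ≤ K ω}) ≤ a (k + 1) :=
          measureReal_mono inter_subset_right
        have hslope := hconv.increment_le_slope_mul (hmem (A ∩ {ω | k ≤ K ω}))
          (hmem (A ∩ {ω | k + 1 ≤ K ω})) (hmem {ω | k ≤ K ω}) (hmem {ω | k + 1 ≤ K ω})
          (by linarith [(hmem (A ∩ {ω | K ω = k})).1]) hA3
          (by simp only [a] at htail; linarith [htail k])
        rw [setIntegral_inter_tail_succ P φ hK hN hA k,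
          show P.real (A ∩ {ω | K ω = k}) =
            P.real (A ∩ {ω | k ≤ K ω}) - P.real (A ∩ {ω | k + 1 ≤ K ω}) by linarith]
        simp only [φ, a] at ih ⊢
        linarith
      · rw [hempty (N + 1) le_rfl]
        simp [hH.2.1]
    simpa using key

lemma sum_setIntegral_tail (P : Measure Ω) {m : Ω → ℝ} (hm : Integrable m P) {L : Ω → ℕ}
    (hL : Measurable L) {N : ℕ} (hN : ∀ ω, L ω ≤ N) :
    ∑ k ∈ Finset.range N, ∫ ω in {ω | k + 1 ≤ L ω}, m ω ∂P = ∫ ω, (L ω : ℝ) * m ω ∂P := by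
  have hmeas : ∀ k, MeasurableSet {ω | k + 1 ≤ L ω} := fun k => hL measurableSet_Ici
  simp_rw [← integral_indicator (hmeas _)]
  rw [← integral_finsetSum _ fun k _ => hm.indicator (hmeas k)]
  congr 1
  ext ω
  simp only [indicator_apply, mem_ofPred_eq]
  rw [Finset.sum_ite, Finset.sum_const_zero, add_zero, Finset.sum_const, nsmul_eq_mul]
  congr 2
  have : (Finset.range N).filter (fun k => k + 1 ≤ L ω) = Finset.range (L ω) := by
    ext k
    have := hN ω
    simp only [Finset.mem_filter, Finset.mem_range]
    omega
  rw [this, Finset.card_range]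

/-- The lower bound for integer-valued allocations, up to an additive error. -/
lemma sum_funInfConv_tail_le (P : Measure Ω) [IsProbabilityMeasure P] {n : ℕ} (hn : 0 < n)
    {h : Fin n → ℝ → ℝ} (hH : ∀ i, MemH (h i)) (hconv : ∀ i, ConvexOn ℝ (Icc 0 1) (h i))
    {K : Fin n → Ω → ℕ} (hK : ∀ i, Measurable (K i)) {L : Ω → ℕ} (hL : Measurable L) {N : ℕ}
    (hKN : ∀ i ω, K i ω ≤ N) (hLN : ∀ ω, L ω ≤ N) {c : ℕ}
    (hLK : ∀ᵐ ω ∂P, L ω ≤ c + ∑ i, K i ω) :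
    ∑ k ∈ Finset.range N, funInfConv h (P.real {ω | k + 1 ≤ L ω}) ≤
      c + ∑ i, ∑ k ∈ Finset.range N, h i (P.real {ω | k + 1 ≤ K i ω}) := by
  have : Nonempty (Fin n) := ⟨⟨0, hn⟩⟩
  choose φ hφ0 hφtail hφA using fun i =>
    exists_distortion_density P (hH i) (hconv i) (hK i) (hKN i)
  have hφint : ∀ i, Integrable (fun ω => φ i (K i ω)) P := fun i =>
    integrable_comp_bounded_nat P (φ i) (hK i) (hKN i)
  choose J hJ using fun v : Fin n → ℕ => Finite.exists_min fun i => φ i (v i)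
  let j : Ω → Fin n := fun ω => J fun i => K i ω
  have hKvec : Measurable fun ω i => K i ω := measurable_pi_lambda _ hK
  have hj : Measurable j := (measurable_of_countable J).comp hKvec
  let m : Ω → ℝ := fun ω => φ (j ω) (K (j ω) ω)
  have hmle : ∀ ω i, m ω ≤ φ i (K i ω) := fun ω i => hJ (fun i => K i ω) i
  have hm0 : ∀ ω, 0 ≤ m ω := fun ω => hφ0 _ _
  have hmmeas : Measurable m :=
    (measurable_of_countable fun v : Fin n → ℕ => φ (J v) (v (J v))).comp hKvec
  have hmint : Integrable m P :=
    (hφint ⟨0, hn⟩).mono' hmmeas.aestronglyMeasurable (ae_of_all _ fun ω => by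
      rw [Real.norm_of_nonneg (hm0 ω)]; exact hmle ω _)
  have hgA : ∀ A, MeasurableSet A → funInfConv h (P.real A) ≤ ∫ ω in A, m ω ∂P := by
    intro A hA
    let B : Fin n → Set Ω := fun i => A ∩ {ω | j ω = i}
    have hB : ∀ i, MeasurableSet (B i) := fun i => hA.inter (hj (measurableSet_singleton i))
    have hdisj : Pairwise (Function.onFun Disjoint B) := fun i i' hii => by
      rw [Function.onFun, Set.disjoint_left]
      rintro ω ⟨-, h1⟩ ⟨-, h2⟩
      exact hii (h1.symm.trans h2)
    have hUn : A = ⋃ i, B i := by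
      ext ω
      simp [B]
    have hP : P.real A = ∑ i, P.real (B i) := by
      conv_lhs => rw [hUn]
      exact measureReal_iUnion_fintype hdisj hB
    have hI : ∫ ω in A, m ω ∂P = ∑ i, ∫ ω in B i, φ i (K i ω) ∂P := by
      conv_lhs => rw [hUn]
      rw [integral_iUnion_fintype hB hdisj fun i => hmint.integrableOn]
      refine Finset.sum_congr rfl fun i _ => setIntegral_congr_fun (hB i) fun ω hω => ?_
      have hω2 : j ω = i := hω.2
      simp only [m, hω2]
    rw [hP, hI]
    exact (funInfConv_le hH fun i => ⟨measureReal_nonneg, measureReal_le_one⟩).trans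
      (Finset.sum_le_sum fun i _ => hφA i (B i) (hB i))
  have hmulint : ∀ {M : Ω → ℕ} {f : Ω → ℝ}, Measurable M → (∀ ω, M ω ≤ N) → Integrable f P →
      Integrable (fun ω => (M ω : ℝ) * f ω) P := fun {M f} hM hMN hf =>
    hf.bdd_mul (c := N) ((measurable_of_countable _).comp hM).aestronglyMeasurable
      (ae_of_all _ fun ω => by
        rw [Real.norm_of_nonneg (Nat.cast_nonneg _)]; exact_mod_cast hMN ω)
  have hm1 : ∫ ω, m ω ∂P ≤ 1 := by
    refine (integral_mono hmint (hφint ⟨0, hn⟩) fun ω => hmle ω _).trans ?_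
    have := hφtail ⟨0, hn⟩ 0
    simp only [Nat.zero_le, ofPred_true, setIntegral_univ, probReal_univ, (hH _).2.2] at this
    exact this.le
  have hKint : ∀ i, Integrable (fun ω => (K i ω : ℝ) * φ i (K i ω)) P := fun i =>
    hmulint (hK i) (hKN i) (hφint i)
  calc ∑ k ∈ Finset.range N, funInfConv h (P.real {ω | k + 1 ≤ L ω})
      ≤ ∑ k ∈ Finset.range N, ∫ ω in {ω | k + 1 ≤ L ω}, m ω ∂P :=
        Finset.sum_le_sum fun k _ => hgA _ (hL measurableSet_Ici)
    _ = ∫ ω, (L ω : ℝ) * m ω ∂P := sum_setIntegral_tail P hmint hL hLN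
    _ ≤ ∫ ω, (c * m ω + ∑ i, (K i ω : ℝ) * φ i (K i ω)) ∂P := by
        refine integral_mono_ae (hmulint hL hLN hmint)
          ((hmint.const_mul _).add (integrable_finsetSum _ fun i _ => hKint i)) ?_
        filter_upwards [hLK] with ω hω
        have hω' : (L ω : ℝ) ≤ c + ∑ i, (K i ω : ℝ) := by exact_mod_cast hω
        calc (L ω : ℝ) * m ω ≤ (c + ∑ i, (K i ω : ℝ)) * m ω :=
              mul_le_mul_of_nonneg_right hω' (hm0 ω)
          _ = c * m ω + ∑ i, (K i ω : ℝ) * m ω := by rw [add_mul, Finset.sum_mul]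
          _ ≤ _ := by
              gcongr with i _
              exact hmle ω i
    _ = c * ∫ ω, m ω ∂P + ∑ i, ∫ ω, (K i ω : ℝ) * φ i (K i ω) ∂P := by
        rw [integral_add (hmint.const_mul _) (integrable_finsetSum _ fun i _ => hKint i),
          integral_const_mul, integral_finsetSum _ fun i _ => hKint i]
    _ ≤ c + ∑ i, ∑ k ∈ Finset.range N, h i (P.real {ω | k + 1 ≤ K i ω}) := by
        refine add_le_add (mul_le_of_le_one_right (Nat.cast_nonneg _) hm1)
          (Finset.sum_le_sum fun i _ => ?_)
        rw [← sum_setIntegral_tail P (hφint i) (hK i) (hKN i)]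
        exact Finset.sum_le_sum fun k _ => (hφtail i (k + 1)).le

/-- Randomising with an independent uniform variable realises prescribed conditional
probabilities given `K`. -/
lemma exists_randomized_partition (P : Measure Ω) [IsProbabilityMeasure P] {n : ℕ}
    {K : Ω → ℕ} (hK : Measurable K) {U : Ω → ℝ} (hU : Measurable U)
    (hUunif : Measure.map U P = volume.restrict (Icc (0:ℝ) 1)) (hindep : IndepFun U K P)
    {θ : ℕ → Fin n → ℝ} (hθ0 : ∀ k i, 0 ≤ θ k i) (hθ1 : ∀ k, ∑ i, θ k i = 1) :
    ∃ B : Fin n → Set Ω, (∀ i, MeasurableSet (B i)) ∧ Pairwise (Function.onFun Disjoint B) ∧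
      ∀ i k, P.real (B i ∩ {ω | K ω = k}) = θ k i * P.real {ω | K ω = k} := by
  let c : Fin n → ℕ → ℝ := fun i k => ∑ j ∈ Finset.Iio i, θ k j
  have hc0 : ∀ i k, 0 ≤ c i k := fun i k => Finset.sum_nonneg fun j _ => hθ0 k j
  have hIic : ∀ i k, c i k + θ k i = ∑ j ∈ Finset.Iic i, θ k j := fun i k => by
    rw [← Finset.Iio_insert, Finset.sum_insert (by simp), add_comm]
  have hc1 : ∀ i k, c i k + θ k i ≤ 1 := fun i k => by
    rw [hIic, ← hθ1 k]
    exact Finset.sum_le_sum_of_subset_of_nonneg (Finset.subset_univ _) fun j _ _ => hθ0 k j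
  have hlt : ∀ {i i'} k, i < i' → c i k + θ k i ≤ c i' k := fun {i i'} k hii => by
    rw [hIic]
    refine Finset.sum_le_sum_of_subset_of_nonneg (fun j hj => ?_) fun j _ _ => hθ0 k j
    exact Finset.mem_Iio.2 ((Finset.mem_Iic.1 hj).trans_lt hii)
  have hdisj : ∀ {i i'} ω, i < i' → U ω < c i (K ω) + θ (K ω) i → c i' (K ω) ≤ U ω → False :=
    fun ω hii h1 h2 => absurd (hlt (K ω) hii) (by linarith)
  refine ⟨fun i => {ω | c i (K ω) ≤ U ω ∧ U ω < c i (K ω) + θ (K ω) i}, fun i => ?_,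
    fun i i' hii => ?_, fun i k => ?_⟩
  · have h1 : Measurable fun ω => c i (K ω) := (measurable_of_countable (c i)).comp hK
    have h2 : Measurable fun ω => c i (K ω) + θ (K ω) i :=
      (measurable_of_countable fun k => c i k + θ k i).comp hK
    exact (measurableSet_le h1 hU).inter (measurableSet_lt hU h2)
  · rw [Function.onFun, Set.disjoint_left]
    rintro ω ⟨h1, h2⟩ ⟨h3, h4⟩
    rcases lt_or_gt_of_ne hii with hlt' | hlt'
    · exact hdisj ω hlt' h2 h3
    · exact hdisj ω hlt' h4 h1
  · have hset : {ω | c i (K ω) ≤ U ω ∧ U ω < c i (K ω) + θ (K ω) i} ∩ {ω | K ω = k} =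
        U ⁻¹' (Ico (c i k) (c i k + θ k i)) ∩ K ⁻¹' {k} := by
      ext ω
      simp only [mem_inter_iff, mem_ofPred_eq, mem_preimage, mem_Ico, mem_singleton_iff]
      constructor
      · rintro ⟨h1, rfl⟩; exact ⟨h1, rfl⟩
      · rintro ⟨h1, rfl⟩; exact ⟨h1, rfl⟩
    have hsub : Ico (c i k) (c i k + θ k i) ⊆ Icc 0 1 := fun x hx =>
      ⟨(hc0 i k).trans hx.1, hx.2.le.trans (hc1 i k)⟩
    have hU' : P.real (U ⁻¹' (Ico (c i k) (c i k + θ k i))) = θ k i := by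
      rw [measureReal_def, ← Measure.map_apply hU measurableSet_Ico, hUunif,
        Measure.restrict_eq_self _ hsub,
        Real.volume_Ico, add_sub_cancel_left, ENNReal.toReal_ofReal (hθ0 k i)]
    rw [hset, measureReal_def, hindep.measure_inter_preimage_eq_mul _ _ measurableSet_Ico
      (measurableSet_singleton k), ENNReal.toReal_mul, ← measureReal_def, hU']
    rfl

/-- A partition which is optimal simultaneously on all upper level sets of `K`. -/
lemma exists_optimal_partition (P : Measure Ω) [IsProbabilityMeasure P] {n : ℕ} (hn : 0 < n)
    {h : Fin n → ℝ → ℝ} (hH : ∀ i, MemH (h i))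
    (hcont : ∀ i, ContinuousOn (h i) (Icc 0 1)) (hconv : ∀ i, ConvexOn ℝ (Icc 0 1) (h i))
    {K : Ω → ℕ} (hK : Measurable K) {N : ℕ} (hN : ∀ ω, K ω ≤ N) {U : Ω → ℝ} (hU : Measurable U)
    (hUunif : Measure.map U P = volume.restrict (Icc (0:ℝ) 1)) (hindep : IndepFun U K P) :
    ∃ B : Fin n → Set Ω, (∀ i, MeasurableSet (B i)) ∧ Pairwise (Function.onFun Disjoint B) ∧
      (∀ᵐ ω ∂P, ω ∈ ⋃ i, B i) ∧
      ∀ k, ∑ i, h i (P.real (B i ∩ {ω | k ≤ K ω})) = funInfConv h (P.real {ω | k ≤ K ω}) := by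
  let a : ℕ → ℝ := fun k => P.real {ω | k ≤ K ω}
  have ha : Antitone a := fun k l hkl =>
    measureReal_mono fun ω (hω : l ≤ K ω) => hkl.trans hω
  have ha01 : ∀ k, a k ∈ Icc (0:ℝ) 1 := fun k => ⟨measureReal_nonneg, measureReal_le_one⟩
  have htail : ∀ k, a k = a (k + 1) + P.real {ω | K ω = k} := fun k => by
    simpa only [univ_inter] using measureReal_inter_tail_succ P hK MeasurableSet.univ k
  have hempty : ∀ k, N + 1 ≤ k → {ω | k ≤ K ω} = ∅ := fun k hk =>
    eq_empty_of_forall_notMem fun ω (hω : k ≤ K ω) => by have := hN ω; omega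
  have ha_zero : ∀ k, N + 1 ≤ k → a k = 0 := fun k hk => by
    simp only [a]
    rw [hempty k hk, measureReal_empty]
  obtain ⟨s, hs, hs_mono⟩ := exists_monotone_isOptSplit hn hcont hconv
    (b := fun d => a (N + 1 - d)) (fun d e hde => ha (by omega)) fun d => ha01 _
  let t : ℕ → Fin n → ℝ := fun k => s (N + 1 - k)
  have ht : ∀ k, IsOptSplit h (a k) (t k) := fun k => by
    rcases le_total k (N + 1) with hk | hk
    · simpa only [Nat.sub_sub_self hk] using hs (N + 1 - k)
    · have := hs (N + 1 - k)
      rwa [ha_zero _ (by omega : N + 1 ≤ N + 1 - (N + 1 - k)), ← ha_zero k hk] at this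
  have ht_anti : ∀ k i, t (k + 1) i ≤ t k i := fun k i =>
    monotone_nat_of_le_succ (f := fun d => s d i) (fun d => hs_mono d i) (by omega)
  have ht_zero : ∀ i, t (N + 1) i = 0 := fun i =>
    (Finset.sum_eq_zero_iff_of_nonneg fun i _ => ((ht (N + 1)).1 i).1).1
      ((ht (N + 1)).2.1.trans (ha_zero _ le_rfl)) i (Finset.mem_univ i)
  have hθ : ∀ k, ∃ θ : Fin n → ℝ, (∀ i, 0 ≤ θ i) ∧ ∑ i, θ i = 1 ∧
      ∀ i, θ i * (a k - a (k + 1)) = t k i - t (k + 1) i := by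
    intro k
    have hsum : ∑ i, (t k i - t (k + 1) i) = a k - a (k + 1) := by
      rw [Finset.sum_sub_distrib, (ht k).2.1, (ht (k + 1)).2.1]
    rcases (ha k.le_succ).eq_or_lt with heq | hlt
    · refine ⟨fun _ => (n : ℝ)⁻¹, fun _ => by positivity, ?_, fun i => ?_⟩
      · have : (n : ℝ) ≠ 0 := by exact_mod_cast hn.ne'
        simp [this]
      · rw [Nat.succ_eq_add_one] at heq
        rw [heq, sub_self] at hsum
        rw [heq, sub_self, mul_zero]
        exact ((Finset.sum_eq_zero_iff_of_nonneg fun i _ => sub_nonneg.2 (ht_anti k i)).1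
          hsum i (Finset.mem_univ i)).symm
    · have hpos : 0 < a k - a (k + 1) := sub_pos.2 hlt
      refine ⟨fun i => (t k i - t (k + 1) i) / (a k - a (k + 1)),
        fun i => div_nonneg (sub_nonneg.2 (ht_anti k i)) hpos.le, ?_,
        fun i => div_mul_cancel₀ _ hpos.ne'⟩
      rw [← Finset.sum_div, hsum, div_self hpos.ne']
  choose θ hθ0 hθ1 hθt using hθ
  obtain ⟨B, hB, hBdisj, hBK⟩ := exists_randomized_partition P hK hU hUunif hindep hθ0 hθ1
  have hBt : ∀ i k, k ≤ N + 1 → P.real (B i ∩ {ω | k ≤ K ω}) = t k i := by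
    intro i k hk
    refine Nat.decreasingInduction (motive := fun k _ => P.real (B i ∩ {ω | k ≤ K ω}) = t k i)
      (fun k _ ih => ?_) ?_ hk
    · rw [measureReal_inter_tail_succ P hK (hB i), ih, hBK,
        show P.real {ω | K ω = k} = a k - a (k + 1) by linarith [htail k], hθt]
      ring
    · rw [hempty (N + 1) le_rfl, ht_zero, inter_empty, measureReal_empty]
  refine ⟨B, hB, hBdisj, ?_, fun k => ?_⟩
  · refine (mem_ae_iff_prob_eq_one (MeasurableSet.iUnion hB)).2 ?_
    have h1 : P.real (⋃ i, B i) = 1 := by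
      rw [measureReal_iUnion_fintype hBdisj hB]
      calc ∑ i, P.real (B i) = ∑ i, t 0 i :=
            Finset.sum_congr rfl fun i _ => by simpa using hBt i 0 (Nat.zero_le _)
        _ = 1 := by simp [(ht 0).2.1, a]
    rwa [measureReal_def, ENNReal.toReal_eq_one_iff] at h1
  · rcases le_total k (N + 1) with hk | hk
    · simp_rw [hBt _ k hk]
      exact ((ht k).funInfConv_eq hH).symm
    · rw [hempty k hk]
      simp [funInfConv_zero hn hH hcont, (hH _).2.1]

lemma setOf_le_floor_div {α : Type*} {X : α → ℝ} (hX : ∀ ω, 0 ≤ X ω) {δ : ℝ} (hδ : 0 < δ)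
    (k : ℕ) : {ω | k ≤ ⌊X ω / δ⌋₊} = {ω | k * δ ≤ X ω} := by
  ext ω
  simp only [mem_ofPred_eq]
  rw [Nat.le_floor_iff (div_nonneg (hX ω) hδ.le), le_div_iff₀ hδ]

lemma floor_div_le {x δ : ℝ} (hδ : 0 < δ) {N : ℕ} (hx : x ≤ N * δ) : ⌊x / δ⌋₊ ≤ N :=
  Nat.floor_le_of_le ((div_le_iff₀ hδ).2 hx)

lemma distortionPos_funInfConv_le (P : Measure Ω) [IsProbabilityMeasure P] {n : ℕ} (hn : 0 < n)
    {h : Fin n → ℝ → ℝ} (hH : ∀ i, MemH (h i))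
    (hcont : ∀ i, ContinuousOn (h i) (Icc 0 1)) (hconv : ∀ i, ConvexOn ℝ (Icc 0 1) (h i))
    {X : Ω → ℝ} (hX : MemLpos X) {Xs : Fin n → Ω → ℝ} (hXs : IsAllocPos P X Xs) {δ : ℝ}
    (hδ : 0 < δ) :
    distortionPos P (funInfConv h) X ≤ ∑ i, distortionPos P (h i) (Xs i) + (n + 1) * δ := by
  obtain ⟨hXm, hX0, M, hM⟩ := hX
  choose hXsm hXs0 Ms hMs using hXs.1
  obtain ⟨N, hN⟩ := exists_nat_ge (max M (∑ i, |Ms i|) / δ)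
  rw [div_le_iff₀ hδ] at hN
  have hXN : ∀ ω, X ω ≤ N * δ := fun ω => (hM ω).trans ((le_max_left _ _).trans hN)
  have hXsN : ∀ i ω, Xs i ω ≤ N * δ := fun i ω =>
    (hMs i ω).trans ((le_abs_self _).trans ((Finset.single_le_sum
      (f := fun i => |Ms i|) (fun _ _ => abs_nonneg _) (Finset.mem_univ i)).trans
      ((le_max_right _ _).trans hN)))
  have key := sum_funInfConv_tail_le P hn hH hconv (K := fun i ω => ⌊Xs i ω / δ⌋₊)
    (fun i => ((hXsm i).div_const δ).nat_floor) (L := fun ω => ⌊X ω / δ⌋₊)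
    (hXm.div_const δ).nat_floor (fun i ω => floor_div_le hδ (hXsN i ω))
    (fun ω => floor_div_le hδ (hXN ω)) (c := n) (by
      filter_upwards [hXs.2] with ω hω
      have h1 : (⌊X ω / δ⌋₊ : ℝ) ≤ X ω / δ := Nat.floor_le (div_nonneg (hX0 ω) hδ.le)
      have h2 : X ω / δ ≤ ∑ i, ((⌊Xs i ω / δ⌋₊ : ℝ) + 1) := by
        rw [← hω, Finset.sum_div]
        exact Finset.sum_le_sum fun i _ => (Nat.lt_floor_add_one _).le
      rw [Finset.sum_add_distrib, Finset.sum_const, Finset.card_univ, Fintype.card_fin,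
        nsmul_one] at h2
      have h3 : (⌊X ω / δ⌋₊ : ℝ) ≤ n + ∑ i, (⌊Xs i ω / δ⌋₊ : ℝ) := by linarith
      exact_mod_cast h3)
  simp only [setOf_le_floor_div hX0 hδ, setOf_le_floor_div (hXs0 _) hδ] at key
  have hup := (distortionPos_riemann_bounds P (funInfConv_monotoneOn hn hH hcont hconv)
    (funInfConv_zero hn hH hcont) hδ N hXN).2
  have hlow := Finset.sum_le_sum fun i (_ : i ∈ Finset.univ) =>
    (distortionPos_riemann_bounds P (hH i).1 (hH i).2.1 hδ N (hXsN i)).1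
  rw [← Finset.mul_sum] at hlow
  have h1 := funInfConv_one_le hn hH
  have := mul_le_mul_of_nonneg_left (add_le_add h1 key) hδ.le
  linarith

lemma counterMonotone_of_mul_eq_zero (P : Measure Ω) {X Y : Ω → ℝ} (hX : ∀ ω, 0 ≤ X ω)
    (hY : ∀ ω, 0 ≤ Y ω) (hXY : ∀ ω, X ω * Y ω = 0) : CounterMonotone P X Y :=
  ae_of_all _ fun p => by
    nlinarith [hXY p.1, hXY p.2, mul_nonneg (hX p.1) (hY p.2), mul_nonneg (hX p.2) (hY p.1)]

lemma exists_counterMonotone_alloc_le (P : Measure Ω) [IsProbabilityMeasure P] {n : ℕ}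
    (hn : 0 < n) {h : Fin n → ℝ → ℝ} (hH : ∀ i, MemH (h i))
    (hcont : ∀ i, ContinuousOn (h i) (Icc 0 1)) (hconv : ∀ i, ConvexOn ℝ (Icc 0 1) (h i))
    {X : Ω → ℝ} (hX : MemLpos X) {U : Ω → ℝ} (hU : Measurable U)
    (hUunif : Measure.map U P = volume.restrict (Icc (0:ℝ) 1)) (hindep : IndepFun U X P)
    {δ : ℝ} (hδ : 0 < δ) :
    ∃ Xs : Fin n → Ω → ℝ, IsAllocPos P X Xs ∧ PairwiseCtr P Xs ∧
      ∑ i, distortionPos P (h i) (Xs i) ≤ distortionPos P (funInfConv h) X + n * δ := by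
  obtain ⟨hXm, hX0, M, hM⟩ := hX
  obtain ⟨N, hN⟩ := exists_nat_ge (M / δ)
  rw [div_le_iff₀ hδ] at hN
  have hXN : ∀ ω, X ω ≤ N * δ := fun ω => (hM ω).trans hN
  have hfloor : Measurable fun x : ℝ => ⌊x / δ⌋₊ := (measurable_id.div_const δ).nat_floor
  obtain ⟨B, hB, hBdisj, hBcover, hBopt⟩ := exists_optimal_partition P hn hH hcont hconv
    (K := fun ω => ⌊X ω / δ⌋₊) (hfloor.comp hXm) (fun ω => floor_div_le hδ (hXN ω)) hU hUunif
    (hindep.comp measurable_id hfloor)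
  simp only [setOf_le_floor_div hX0 hδ] at hBopt
  let Xs : Fin n → Ω → ℝ := fun i => (B i).indicator X
  have hXs0 : ∀ i ω, 0 ≤ Xs i ω := fun i ω => indicator_nonneg (fun ω _ => hX0 ω) ω
  have hXsX : ∀ i ω, Xs i ω ≤ X ω := fun i ω => indicator_le_self' (fun ω _ => hX0 ω) ω
  refine ⟨Xs, ⟨fun i => ⟨hXm.indicator (hB i), hXs0 i, M, fun ω => (hXsX i ω).trans (hM ω)⟩, ?_⟩,
    fun i j hij => counterMonotone_of_mul_eq_zero P (hXs0 i) (hXs0 j) fun ω => ?_, ?_⟩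
  · filter_upwards [hBcover] with ω hω
    obtain ⟨i, hi⟩ := mem_iUnion.1 hω
    rw [Finset.sum_eq_single i (fun j _ hji => ?_) (by simp)]
    · exact indicator_of_mem hi X
    · exact indicator_of_notMem (Set.disjoint_left.1 (hBdisj hji.symm) hi) X
  · by_cases hi : ω ∈ B i
    · simp only [Xs]
      rw [indicator_of_notMem (Set.disjoint_left.1 (hBdisj hij) hi), mul_zero]
    · simp only [Xs]
      rw [indicator_of_notMem hi, zero_mul]
  · have hset : ∀ i (k : ℕ), {ω | (k + 1 : ℕ) * δ ≤ Xs i ω} =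
        B i ∩ {ω | (k + 1 : ℕ) * δ ≤ X ω} := fun i k => by
      have hpos : 0 < (k + 1 : ℕ) * δ := by positivity
      ext ω
      by_cases hi : ω ∈ B i
      · simp [Xs, hi]
      · simp only [Xs, mem_ofPred_eq, indicator_of_notMem hi, mem_inter_iff, hi, false_and,
          iff_false, not_le]
        exact hpos
    have hup := Finset.sum_le_sum fun i (_ : i ∈ Finset.univ) =>
      (distortionPos_riemann_bounds P (hH i).1 (hH i).2.1 hδ N
        fun ω => (hXsX i ω).trans (hXN ω)).2
    have hlow := (distortionPos_riemann_bounds P (funInfConv_monotoneOn hn hH hcont hconv)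
      (funInfConv_zero hn hH hcont) hδ N hXN).1
    simp only [hset, (hH _).2.2] at hup
    rw [← Finset.mul_sum, Finset.sum_add_distrib, Finset.sum_comm] at hup
    simp only [hBopt, Finset.sum_const, Finset.card_univ, Fintype.card_fin, nsmul_one] at hup
    linarith

/-- Theorem 2 on `L^+`. If each `h_i ∈ H` is continuous and convex on
`[0,1]`, `X ∈ L^+`, and there is a uniform random variable on `[0,1]` independent of `X`,
then `□ ρ_{h_i}(X) = ⊟ ρ_{h_i}(X) = ρ_g(X)` where `g = □_{i=1}^n h_i`. -/
theorem infConv_convex_Lplus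
    (P : Measure Ω) [IsProbabilityMeasure P] (hP : Atomless P)
    {n : ℕ} (hn : 0 < n)
    (h : Fin n → ℝ → ℝ) (hH : ∀ i, MemH (h i))
    (hcont : ∀ i, ContinuousOn (h i) (Icc 0 1))
    (hconv : ∀ i, ConvexOn ℝ (Icc 0 1) (h i))
    (X : Ω → ℝ) (hX : MemLpos X)
    (U : Ω → ℝ) (hU : Measurable U)
    (hUunif : Measure.map U P = volume.restrict (Icc (0:ℝ) 1))
    (hindep : IndepFun U X P) :
    infConvPos P h X = ctrInfConvPos P h X ∧
    ctrInfConvPos P h X = ((distortionPos P (funInfConv h) X : ℝ) : EReal) := by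
  have hlower : ((distortionPos P (funInfConv h) X : ℝ) : EReal) ≤ infConvPos P h X := by
    refine le_sInf ?_
    rintro y ⟨Xs, hXs, rfl⟩
    rw [EReal.coe_le_coe_iff]
    refine le_of_forall_pos_le_add fun ε hε => ?_
    have hn1 : (0:ℝ) < n + 1 := by positivity
    have := distortionPos_funInfConv_le P hn hH hcont hconv hX hXs (div_pos hε hn1)
    rwa [mul_div_cancel₀ _ hn1.ne'] at this
  have hmid : infConvPos P h X ≤ ctrInfConvPos P h X :=
    sInf_le_sInf fun y ⟨Xs, hXs, _, hy⟩ => ⟨Xs, hXs, hy⟩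
  have hupper : ctrInfConvPos P h X ≤ ((distortionPos P (funInfConv h) X : ℝ) : EReal) := by
    refine EReal.le_of_forall_lt_iff_le.1 fun z hz => ?_
    rw [EReal.coe_lt_coe_iff] at hz
    have hn0 : (0:ℝ) < n := by exact_mod_cast hn
    obtain ⟨Xs, hXs, hctr, hle⟩ := exists_counterMonotone_alloc_le P hn hH hcont hconv hX hU
      hUunif hindep (div_pos (sub_pos.2 hz) hn0)
    rw [mul_div_cancel₀ _ hn0.ne', add_sub_cancel] at hle
    refine le_trans (sInf_le ?_) (EReal.coe_le_coe_iff.2 hle)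
    exact ⟨Xs, hXs, hctr, rfl⟩
  exact ⟨le_antisymm hmid (hupper.trans hlower), le_antisymm hupper (hlower.trans hmid)⟩
end
end

section
/- Let (Ω,F,P) be atomless, x > 0 a real number, X any random variable, and h ∈ H. Then inf{ Σ_{i=1}^n h(P(X·1_{A_i} ≥ x)) : (A_1,…,A_n) ∈ Π_n } = (□_{i=1}^n h)(P(X ≥ x)), where □_{i=1}^n h denotes the n-fold inf-convolution of h with itself. -/
open MeasureTheory ProbabilityTheory Set

noncomputable section

variable {Ω : Type*} [MeasurableSpace Ω]

/-- An `n`-composition of `Ω`: pairwise disjoint measurable sets whose union is `Ω`. -/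
def IsComposition {n : ℕ} (A : Fin n → Set Ω) : Prop :=
  (∀ i, MeasurableSet (A i)) ∧ (∀ i j, i ≠ j → A i ∩ A j = ∅) ∧ (⋃ i, A i) = univ

/-- In an atomless finite measure space, every set of positive measure has subsets of
arbitrarily small positive measure. -/
theorem Atomless.exists_subset_measureReal_lt {P : Measure Ω} [IsFiniteMeasure P]
    (hP : Atomless P) {A : Set Ω} (hA : MeasurableSet A) (hpos : 0 < P.real A)
    {ε : ℝ} (hε : 0 < ε) :
    ∃ B, B ⊆ A ∧ MeasurableSet B ∧ 0 < P.real B ∧ P.real B < ε := by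
  have halving : ∀ k : ℕ, ∃ B, B ⊆ A ∧ MeasurableSet B ∧ 0 < P.real B ∧
      P.real B ≤ P.real A * (1 / 2) ^ k := by
    intro k
    induction k with
    | zero => exact ⟨A, Subset.rfl, hA, hpos, by simp⟩
    | succ k ih =>
      obtain ⟨B, hBA, hB, hB0, hBk⟩ := ih
      obtain ⟨C, hCB, hC, hC0, hCB'⟩ := hP B hB (ENNReal.toReal_pos_iff.1 hB0).1
      have hC0' : 0 < P.real C := ENNReal.toReal_pos hC0.ne' (measure_ne_top _ _)
      have hCB'' : P.real C < P.real B :=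
        (ENNReal.toReal_lt_toReal (measure_ne_top _ _) (measure_ne_top _ _)).2 hCB'
      have hdiff : P.real (B \ C) = P.real B - P.real C := measureReal_sdiff hCB hC
      rcases le_total (P.real C) (P.real B / 2) with hle | hle
      · exact ⟨C, hCB.trans hBA, hC, hC0', by rw [pow_succ]; linarith⟩
      · exact ⟨B \ C, sdiff_subset.trans hBA, hB.diff hC, by linarith,
          by rw [pow_succ]; linarith⟩
  obtain ⟨k, hk⟩ := exists_pow_lt_of_lt_one (div_pos hε hpos) (by norm_num : (1 / 2 : ℝ) < 1)
  obtain ⟨B, hBA, hB, hB0, hBk⟩ := halving k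
  refine ⟨B, hBA, hB, hB0, hBk.trans_lt ?_⟩
  rwa [lt_div_iff₀ hpos, mul_comm] at hk

/-- Sierpiński's theorem: an atomless finite measure takes all intermediate values. -/
theorem Atomless.exists_subset_measureReal_eq {P : Measure Ω} [IsFiniteMeasure P]
    (hP : Atomless P) {A : Set Ω} (hA : MeasurableSet A)
    {t : ℝ} (ht0 : 0 ≤ t) (htA : t ≤ P.real A) :
    ∃ B, B ⊆ A ∧ MeasurableSet B ∧ P.real B = t := by
  let S := {B : Set Ω // B ⊆ A ∧ MeasurableSet B ∧ P.real B ≤ t}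
  have step : ∀ (B : S) (k : ℕ), ∃ B' : S, B.1 ⊆ B'.1 ∧
      ∀ C : S, B.1 ⊆ C.1 → P.real C.1 ≤ P.real B'.1 + 1 / ((k : ℝ) + 1) := by
    intro B k
    have hbdd : BddAbove (range fun C : {C : S // B.1 ⊆ C.1} => P.real C.1.1) :=
      ⟨t, by rintro _ ⟨C, rfl⟩; exact C.1.2.2.2⟩
    have : Nonempty {C : S // B.1 ⊆ C.1} := ⟨⟨B, Subset.rfl⟩⟩
    obtain ⟨B', hB'⟩ := exists_lt_of_lt_ciSup
      (sub_lt_self (⨆ C : {C : S // B.1 ⊆ C.1}, P.real C.1.1) (Nat.one_div_pos_of_nat (n := k)))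
    refine ⟨B'.1, B'.2, fun C hC => ?_⟩
    have := le_ciSup hbdd ⟨C, hC⟩
    simp only at this
    linarith
  choose next hnext hnext_max using step
  let B : ℕ → S := fun k =>
    Nat.rec ⟨∅, empty_subset _, MeasurableSet.empty, by simpa using ht0⟩
      (fun k C => next C k) k
  have hmono : Monotone fun k => (B k).1 := monotone_nat_of_le_succ fun k => hnext (B k) k
  have hU : MeasurableSet (⋃ k, (B k).1) := MeasurableSet.iUnion fun k => (B k).2.2.1
  have hUA : (⋃ k, (B k).1) ⊆ A := iUnion_subset fun k => (B k).2.1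
  have hlim : Filter.Tendsto (fun k => P.real (B k).1) Filter.atTop
      (nhds (P.real (⋃ k, (B k).1))) :=
    (ENNReal.tendsto_toReal (measure_ne_top _ _)).comp (tendsto_measure_iUnion_atTop hmono)
  have hUt : P.real (⋃ k, (B k).1) ≤ t := le_of_tendsto' hlim fun k => (B k).2.2.2
  refine ⟨_, hUA, hU, hUt.antisymm ?_⟩
  by_contra! hlt
  have hdiff : P.real (A \ ⋃ k, (B k).1) = P.real A - P.real (⋃ k, (B k).1) :=
    measureReal_sdiff hUA hU
  obtain ⟨D, hDA, hD, hD0, hDt⟩ := hP.exists_subset_measureReal_lt (hA.diff hU)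
    (by linarith) (sub_pos.2 hlt)
  have hunion : P.real ((⋃ k, (B k).1) ∪ D) = P.real (⋃ k, (B k).1) + P.real D :=
    measureReal_union (disjoint_sdiff_right.mono_right hDA) hD
  obtain ⟨k, hk⟩ := exists_nat_one_div_lt hD0
  have hmax := hnext_max (B k) k
    ⟨(⋃ k, (B k).1) ∪ D, union_subset hUA (hDA.trans sdiff_subset), hU.union hD, by linarith⟩
    ((subset_iUnion (fun k => (B k).1) k).trans subset_union_left)
  have hle : P.real (next (B k) k).1 ≤ P.real (⋃ k, (B k).1) :=
    measureReal_mono (subset_iUnion (fun k => (B k).1) (k + 1))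
  simp only at hmax
  linarith

/-- An atomless finite measure admits disjoint subsets of `E` with prescribed measures whose
total does not exceed the measure of `E`. -/
theorem Atomless.exists_disjoint_measureReal_eq {P : Measure Ω} [IsFiniteMeasure P]
    (hP : Atomless P) {n : ℕ} {E : Set Ω} (hE : MeasurableSet E) (t : Fin n → ℝ)
    (ht : ∀ i, 0 ≤ t i) (hsum : ∑ i, t i ≤ P.real E) :
    ∃ B : Fin n → Set Ω, (∀ i, B i ⊆ E) ∧ (∀ i, MeasurableSet (B i)) ∧
      Pairwise (Function.onFun Disjoint B) ∧ ∀ i, P.real (B i) = t i := by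
  induction n generalizing E with
  | zero => exact ⟨fun _ => ∅, by simp, by simp, fun i => i.elim0, fun i => i.elim0⟩
  | succ n ih =>
    rw [Fin.sum_univ_succ] at hsum
    have htail : 0 ≤ ∑ i : Fin n, t i.succ := Finset.sum_nonneg fun i _ => ht _
    obtain ⟨C, hCE, hC, hCt⟩ :=
      hP.exists_subset_measureReal_eq hE (ht 0) (by linarith : t 0 ≤ P.real E)
    have hdiff : P.real (E \ C) = P.real E - P.real C := measureReal_sdiff hCE hC
    obtain ⟨B, hBE, hB, hdisj, hBt⟩ :=
      ih (hE.diff hC) (fun i => t i.succ) (fun i => ht _) (by linarith)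
    have hCB : ∀ i, Disjoint C (B i) := fun i => disjoint_sdiff_right.mono_right (hBE i)
    refine ⟨Fin.cons C B, ?_, ?_, ?_, ?_⟩
    · exact Fin.cases hCE fun i => (hBE i).trans sdiff_subset
    · exact Fin.cases hC hB
    · intro i j
      induction i using Fin.cases with
      | zero =>
        induction j using Fin.cases with
        | zero => exact fun hij => absurd rfl hij
        | succ j => exact fun _ => hCB j
      | succ i =>
        induction j using Fin.cases with
        | zero => exact fun _ => (hCB i).symm
        | succ j => exact fun hij => hdisj fun hij' => hij (congrArg Fin.succ hij')
    · exact Fin.cases hCt hBt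

/-- The traces of a composition on a measurable set have total measure that of the set. -/
theorem IsComposition.sum_measureReal_inter {P : Measure Ω} [IsFiniteMeasure P] {n : ℕ}
    {A : Fin n → Set Ω} (hA : IsComposition A) {E : Set Ω} (hE : MeasurableSet E) :
    ∑ i, P.real (A i ∩ E) = P.real E := by
  rw [← measureReal_iUnion_fintype
    (fun i j hij => ((disjoint_iff_inter_eq_empty.2 (hA.2.1 i j hij)).mono
      inter_subset_left inter_subset_left))
    (fun i => (hA.1 i).inter hE), ← iUnion_inter, hA.2.2, univ_inter]

/-- On an atomless finite measure space, every splitting of the measure of `E` into `n ≥ 1`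
nonnegative parts is realized by a composition. -/
theorem Atomless.exists_isComposition {P : Measure Ω} [IsFiniteMeasure P]
    (hP : Atomless P) {n : ℕ} (hn : 0 < n) {E : Set Ω} (hE : MeasurableSet E) (t : Fin n → ℝ)
    (ht : ∀ i, 0 ≤ t i) (hsum : ∑ i, t i = P.real E) :
    ∃ A : Fin n → Set Ω, IsComposition A ∧ ∀ i, P.real (A i ∩ E) = t i := by
  obtain ⟨m, rfl⟩ := Nat.exists_eq_succ_of_ne_zero hn.ne'
  have hsum' := hsum
  rw [Fin.sum_univ_succ] at hsum'
  obtain ⟨B, hBE, hB, hdisj, hBt⟩ := hP.exists_disjoint_measureReal_eq hE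
    (fun i : Fin m => t i.succ) (fun i => ht _) (by linarith [ht 0])
  have hcompl : ∀ i, Disjoint (⋃ i, B i)ᶜ (B i) := fun i =>
    disjoint_compl_left.mono_right (subset_iUnion B i)
  have hA : IsComposition (Fin.cons (⋃ i, B i)ᶜ B : Fin (m + 1) → Set Ω) := by
    refine ⟨Fin.cases (MeasurableSet.iUnion hB).compl hB, ?_, ?_⟩
    · intro i j hij
      rw [← disjoint_iff_inter_eq_empty]
      induction i using Fin.cases with
      | zero =>
        induction j using Fin.cases with
        | zero => exact absurd rfl hij
        | succ j => exact hcompl j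
      | succ i =>
        induction j using Fin.cases with
        | zero => exact (hcompl i).symm
        | succ j => exact hdisj fun hij' => hij (congrArg Fin.succ hij')
    · refine eq_univ_of_forall fun ω => ?_
      by_cases hω : ω ∈ ⋃ i, B i
      · obtain ⟨i, hi⟩ := mem_iUnion.1 hω
        exact mem_iUnion.2 ⟨i.succ, hi⟩
      · exact mem_iUnion.2 ⟨0, hω⟩
  have hsucc : ∀ i, P.real (B i ∩ E) = t i.succ := fun i => by
    rw [inter_eq_left.2 (hBE i), hBt i]
  have htotal := hA.sum_measureReal_inter (P := P) hE
  rw [Fin.sum_univ_succ] at htotal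
  simp only [Fin.cons_succ, hsucc] at htotal
  exact ⟨_, hA, Fin.cases (by linarith) hsucc⟩

/-- For a positive level, the superlevel set of `X · 1_A` is the trace on `A` of that of `X`. -/
theorem setOf_le_indicator_eq_inter {Ω : Type*} {x : ℝ} (hx : 0 < x) (A : Set Ω) (X : Ω → ℝ) :
    {ω | x ≤ A.indicator X ω} = A ∩ {ω | x ≤ X ω} := by
  ext ω
  by_cases hω : ω ∈ A <;> simp [hω, hx]

/-- Lemma 1. For `x > 0`, any random variable `X` and `h ∈ H` on an
atomless probability space,
`inf { Σ_i h(P(X·1_{A_i} ≥ x)) : (A_1,…,A_n) ∈ Π_n } = (□^n h)(P(X ≥ x))`. -/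
theorem lemma_composition_inf
    (P : Measure Ω) [IsProbabilityMeasure P] (hP : Atomless P)
    {n : ℕ} (hn : 0 < n)
    (x : ℝ) (hx : 0 < x)
    (X : Ω → ℝ) (hX : Measurable X)
    (h : ℝ → ℝ) (hH : MemH h) :
    sInf {y : ℝ | ∃ A : Fin n → Set Ω, IsComposition A ∧
        y = ∑ i, h ((P {ω | x ≤ (A i).indicator X ω}).toReal)} =
      funInfConv (fun _ : Fin n => h) ((P {ω | x ≤ X ω}).toReal) := by
  unfold funInfConv
  have hE : MeasurableSet {ω | x ≤ X ω} := measurableSet_le measurable_const hX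
  simp only [setOf_le_indicator_eq_inter hx, ← measureReal_def]
  congr 1
  ext y
  constructor
  · rintro ⟨A, hA, rfl⟩
    exact ⟨fun i => P.real (A i ∩ {ω | x ≤ X ω}),
      fun i => ⟨measureReal_nonneg, measureReal_le_one⟩, hA.sum_measureReal_inter hE, rfl⟩
  · rintro ⟨t, ht, hsum, rfl⟩
    obtain ⟨A, hA, hAt⟩ := hP.exists_isComposition hn hE t (fun i => (ht i).1) hsum
    exact ⟨A, hA, by simp only [hAt]⟩
end
end

section
/- Suppose each h_i ∈ H (i = 1,…,n) is convex, continuous on [0,1], and twice continuously differentiable on (0,1), and let X be such that there exists a random variable U uniform on [0,1] independent of X. (i) If 𝒳 = L^+ and X ∈ L^+, then □_{i=1}^n ρ_{h_i}(X) = ⊟_{i=1}^n ρ_{h_i}(X) = ρ_g(X) with g = □_{i=1}^n h_i. (ii) If 𝒳 = L^− and X ∈ L^−, then □_{i=1}^n ρ_{h_i}(X) = ⊟_{i=1}^n ρ_{h_i}(X) = ρ_g(X) with g(x) = (◊_{i=1}^n h̃_i)(1) − (◊_{i=1}^n h̃_i)(1−x), where h̃_i(t) = 1 − h_i(1−t).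 -/
open MeasureTheory ProbabilityTheory Set

noncomputable section

variable {Ω : Type*} [MeasurableSpace Ω]

/-- Nonpositive bounded measurable random variables (`L^−`). -/
def MemLneg (X : Ω → ℝ) : Prop :=
  Measurable X ∧ (∀ ω, X ω ≤ 0) ∧ ∃ M : ℝ, ∀ ω, -M ≤ X ω

/-- The distortion riskmetric of a nonpositive random variable:
`ρ_g(X) = ∫_{-∞}^0 (g(P(X ≥ x)) − g(1)) dx`. -/
def distortionNeg (P : Measure Ω) (g : ℝ → ℝ) (X : Ω → ℝ) : ℝ :=
  ∫ x in Iio (0:ℝ), (g ((P {ω | x ≤ X ω}).toReal) - g 1)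

/-- `Xs` is an allocation of `X` within `L^−`. -/
def IsAllocNeg (P : Measure Ω) {n : ℕ} (X : Ω → ℝ) (Xs : Fin n → Ω → ℝ) : Prop :=
  (∀ i, MemLneg (Xs i)) ∧ (∀ᵐ ω ∂P, ∑ i, Xs i ω = X ω)

/-- The inf-convolution `□_{i=1}^n ρ_{h_i}(X)` over allocations in `L^−`. -/
def infConvNeg (P : Measure Ω) {n : ℕ} (h : Fin n → ℝ → ℝ) (X : Ω → ℝ) : EReal :=
  sInf {y : EReal | ∃ Xs : Fin n → Ω → ℝ, IsAllocNeg P X Xs ∧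
    y = ((∑ i, distortionNeg P (h i) (Xs i) : ℝ) : EReal)}

/-- The counter-monotonic inf-convolution `⊟_{i=1}^n ρ_{h_i}(X)` over allocations in `L^−`. -/
def ctrInfConvNeg (P : Measure Ω) {n : ℕ} (h : Fin n → ℝ → ℝ) (X : Ω → ℝ) : EReal :=
  sInf {y : EReal | ∃ Xs : Fin n → Ω → ℝ, IsAllocNeg P X Xs ∧ PairwiseCtr P Xs ∧
    y = ((∑ i, distortionNeg P (h i) (Xs i) : ℝ) : EReal)}

/-- The sup-convolution of functions `l_1, …, l_n` on `[0,1]`: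
`(◊ l_i)(x) = sup { Σ l_i(x_i) : x_i ∈ [0,1], Σ x_i = x }`. -/
def funSupConv {n : ℕ} (l : Fin n → ℝ → ℝ) (x : ℝ) : ℝ :=
  sSup {y : ℝ | ∃ t : Fin n → ℝ, (∀ i, t i ∈ Icc (0:ℝ) 1) ∧ (∑ i, t i) = x ∧
    y = ∑ i, l i (t i)}

/-- Moving two points towards each other by the same amount does not increase the sum
of the values of a convex function. -/
lemma ConvexOn.add_exchange_le {s : Set ℝ} {f : ℝ → ℝ} (hf : ConvexOn ℝ s f) {a b θ : ℝ}
    (ha : a ∈ s) (hb : b ∈ s) (h0 : 0 ≤ θ) (h1 : θ ≤ 1) :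
    f (a + θ * (b - a)) + f (b - θ * (b - a)) ≤ f a + f b := by
  have e1 := hf.2 ha hb (sub_nonneg.2 h1) h0 (by ring)
  have e2 := hf.2 ha hb h0 (sub_nonneg.2 h1) (by ring)
  simp only [smul_eq_mul] at e1 e2
  rw [show (1 - θ) * a + θ * b = a + θ * (b - a) by ring] at e1
  rw [show θ * a + (1 - θ) * b = b - θ * (b - a) by ring] at e2
  linarith

/-- Among the minimizers of a continuous separable objective on a simplex slice of the cube, there
is one with the least sum of squares. -/
lemma exists_minimizer_least_sq {n : ℕ} (hn : 0 < n) {φ : Fin n → ℝ → ℝ}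
    (hcont : ∀ i, ContinuousOn (φ i) (Icc 0 1)) {p : ℝ} (hp : p ∈ Icc (0 : ℝ) 1) :
    ∃ t : Fin n → ℝ, (∀ i, t i ∈ Icc (0 : ℝ) 1) ∧ ∑ i, t i = p ∧
      ∀ s : Fin n → ℝ, (∀ i, s i ∈ Icc (0 : ℝ) 1) → ∑ i, s i = p →
        ∑ i, φ i (t i) ≤ ∑ i, φ i (s i) ∧
        (∑ i, φ i (s i) ≤ ∑ i, φ i (t i) → ∑ i, t i ^ 2 ≤ ∑ i, s i ^ 2) := by
  set K : Set (Fin n → ℝ) := (univ.pi fun _ => Icc (0 : ℝ) 1) ∩ {s | ∑ i, s i = p} with hK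
  have hKc : IsCompact K := by
    refine (isCompact_univ_pi fun _ => isCompact_Icc).inter_right ?_
    exact isClosed_eq (by fun_prop) continuous_const
  have hKne : K.Nonempty := by
    refine ⟨Pi.single ⟨0, hn⟩ p, fun i _ => ?_, ?_⟩
    · by_cases hi : i = ⟨0, hn⟩
      · subst hi; simpa using hp
      · simp [hi]
    · simp
  have hF : ContinuousOn (fun s : Fin n → ℝ => ∑ i, φ i (s i)) K := by
    refine continuousOn_finsetSum _ fun i _ => ?_
    exact (hcont i).comp (continuous_apply i).continuousOn fun s hs => hs.1 i (mem_univ i)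
  obtain ⟨m, hmK, hm⟩ := hKc.exists_isMinOn hKne hF
  have hKmin : IsCompact (K ∩ (fun s : Fin n → ℝ => ∑ i, φ i (s i)) ⁻¹' Iic (∑ i, φ i (m i))) :=
    hKc.of_isClosed_subset (hF.preimage_isClosed_of_isClosed hKc.isClosed isClosed_Iic)
      inter_subset_left
  obtain ⟨t, htK, ht⟩ := hKmin.exists_isMinOn ⟨m, hmK, le_refl (∑ i, φ i (m i))⟩
    (f := fun s : Fin n → ℝ => ∑ i, s i ^ 2) (by fun_prop)
  refine ⟨t, fun i => htK.1.1 i (mem_univ i), htK.1.2, fun s hs hsp => ?_⟩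
  have hsK : s ∈ K := ⟨fun i _ => hs i, hsp⟩
  exact ⟨le_trans htK.2 (hm hsK), fun hle => ht ⟨hsK, le_trans hle htK.2⟩⟩

/-- Convex separable resource allocation admits an optimal solution in which every share is
monotone in the total resource. -/
lemma exists_monotone_minimizer {n : ℕ} (hn : 0 < n) {φ : Fin n → ℝ → ℝ}
    (hconv : ∀ i, ConvexOn ℝ (Icc 0 1) (φ i)) (hcont : ∀ i, ContinuousOn (φ i) (Icc 0 1)) :
    ∃ t : Fin n → ℝ → ℝ, (∀ i, MonotoneOn (t i) (Icc 0 1)) ∧ ∀ p ∈ Icc (0 : ℝ) 1,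
      (∀ i, t i p ∈ Icc (0 : ℝ) 1) ∧ ∑ i, t i p = p ∧
      ∀ s : Fin n → ℝ, (∀ i, s i ∈ Icc (0 : ℝ) 1) → ∑ i, s i = p →
        ∑ i, φ i (t i p) ≤ ∑ i, φ i (s i) := by
  have key := fun (p : Icc (0 : ℝ) 1) => exists_minimizer_least_sq hn hcont p.2
  choose t ht01 htsum htmin using key
  refine ⟨fun i p => if hp : p ∈ Icc (0 : ℝ) 1 then t ⟨p, hp⟩ i else 0, ?_, fun p hp => ?_⟩
  swap
  · simp only [hp, dif_pos]
    exact ⟨ht01 _, htsum _, fun s hs hsp => (htmin ⟨p, hp⟩ s hs hsp).1⟩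
  intro i p hp q hq hpq
  simp only [hp, hq, dif_pos]
  set a := t ⟨p, hp⟩
  set b := t ⟨q, hq⟩
  by_contra! hlt
  obtain ⟨j, hj⟩ : ∃ j, a j < b j := by
    by_contra! hall
    have : ∑ k, b k < ∑ k, a k :=
      Finset.sum_lt_sum (fun k _ => hall k) ⟨i, Finset.mem_univ i, hlt⟩
    rw [htsum, htsum] at this
    exact absurd this (not_lt.2 hpq)
  have hij : i ≠ j := fun e => by subst e; exact lt_asymm hlt hj
  set η := min (a i - b i) (b j - a j) / 2 with hη
  have hmin : 0 < min (a i - b i) (b j - a j) := lt_min (by linarith) (by linarith)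
  have hηi : 2 * η ≤ a i - b i := by
    have := min_le_left (a i - b i) (b j - a j); linarith
  have hηj : 2 * η ≤ b j - a j := by
    have := min_le_right (a i - b i) (b j - a j); linarith
  have hη0 : 0 < η := by linarith
  set θ : Fin n → ℝ := fun k =>
    if k = i then η / (a i - b i) else if k = j then η / (b j - a j) else 0 with hθ
  have hai : (0 : ℝ) < a i - b i := by linarith
  have hbj : (0 : ℝ) < b j - a j := by linarith
  have hθ0 : ∀ k, 0 ≤ θ k := fun k => by
    simp only [hθ]; split_ifs <;> positivity
  have hθ1 : ∀ k, θ k ≤ 1 := fun k => by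
    simp only [hθ]
    split_ifs
    · rw [div_le_one hai]; linarith
    · rw [div_le_one hbj]; linarith
    · exact zero_le_one
  have hd : ∀ k, θ k * (b k - a k) = (if k = j then η else 0) - (if k = i then η else 0) := by
    intro k
    simp only [hθ]
    split_ifs with h1 h2 h2
    · exact absurd (h1.symm.trans h2) hij
    · subst h1; field_simp; ring
    · subst h2; field_simp; ring
    · simp
  have hdsum : ∑ k, θ k * (b k - a k) = 0 := by simp [hd]
  have hmem : ∀ k, a k + θ k * (b k - a k) ∈ Icc (0 : ℝ) 1 ∧
      b k - θ k * (b k - a k) ∈ Icc (0 : ℝ) 1 := fun k => by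
    have h1 := (convex_Icc (0 : ℝ) 1) (ht01 ⟨p, hp⟩ k) (ht01 ⟨q, hq⟩ k)
      (sub_nonneg.2 (hθ1 k)) (hθ0 k) (by ring)
    have h2 := (convex_Icc (0 : ℝ) 1) (ht01 ⟨p, hp⟩ k) (ht01 ⟨q, hq⟩ k)
      (hθ0 k) (sub_nonneg.2 (hθ1 k)) (by ring)
    simp only [smul_eq_mul] at h1 h2
    constructor
    · convert h1 using 1; ring
    · convert h2 using 1; ring
  have hA := htmin ⟨p, hp⟩ (fun k => a k + θ k * (b k - a k)) (fun k => (hmem k).1)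
    (by rw [Finset.sum_add_distrib, hdsum, htsum, add_zero])
  have hB := htmin ⟨q, hq⟩ (fun k => b k - θ k * (b k - a k)) (fun k => (hmem k).2)
    (by rw [Finset.sum_sub_distrib, hdsum, htsum, sub_zero])
  have hsum : ∑ k, φ k (a k + θ k * (b k - a k)) + ∑ k, φ k (b k - θ k * (b k - a k)) ≤
      ∑ k, φ k (a k) + ∑ k, φ k (b k) := by
    rw [← Finset.sum_add_distrib, ← Finset.sum_add_distrib]
    exact Finset.sum_le_sum fun k _ =>
      (hconv k).add_exchange_le (ht01 ⟨p, hp⟩ k) (ht01 ⟨q, hq⟩ k) (hθ0 k) (hθ1 k)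
  have hA2 := hA.2 (by have := hB.1; simp only [a, b] at *; linarith)
  have hB2 := hB.2 (by have := hA.1; simp only [a, b] at *; linarith)
  have hsq : ∑ k, (a k + θ k * (b k - a k)) ^ 2 + ∑ k, (b k - θ k * (b k - a k)) ^ 2 <
      ∑ k, a k ^ 2 + ∑ k, b k ^ 2 := by
    rw [← Finset.sum_add_distrib, ← Finset.sum_add_distrib]
    refine Finset.sum_lt_sum (fun k _ => ?_) ⟨i, Finset.mem_univ i, ?_⟩
    · nlinarith [mul_nonneg (mul_nonneg (hθ0 k) (sub_nonneg.2 (hθ1 k))) (sq_nonneg (b k - a k))]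
    · have := hd i
      simp only [hij, if_false, if_true] at this
      rw [this]
      nlinarith
  simp only [a, b] at *
  linarith

/-- Secant slopes of a convex function increase when both endpoints move to the right. -/
lemma ConvexOn.sub_le_slope_mul {s : Set ℝ} {f : ℝ → ℝ} (hf : ConvexOn ℝ s f) {u a v d : ℝ}
    (hu : u ∈ s) (hua : u + a ∈ s) (hv : v ∈ s) (hvd : v + d ∈ s)
    (ha : 0 ≤ a) (huv : u ≤ v) (huavd : u + a ≤ v + d) (hd : a ≠ 0 → 0 < d) :
    f (u + a) - f u ≤ (f (v + d) - f v) / d * a := by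
  rcases ha.eq_or_lt with rfl | ha
  · simp
  have hd := hd ha.ne'
  have h1 := hf.secant_mono hu hua hvd (by linarith) (by linarith) huavd
  have h2 := hf.secant_mono hvd hu hv (by linarith) (by linarith) huv
  rw [← neg_div_neg_eq, neg_sub, neg_sub, ← neg_div_neg_eq (f v - _), neg_sub, neg_sub] at h2
  have h3 := h1.trans h2
  rwa [add_sub_cancel_left, add_sub_cancel_left, div_le_iff₀ ha] at h3

/-- For a finite chain of events, a convex distortion of `P` is dominated by a measure with bounded
density which agrees with it along the chain. -/
lemma exists_density_of_chain (P : Measure Ω) [IsProbabilityMeasure P] {φ : ℝ → ℝ}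
    (hconv : ConvexOn ℝ (Icc 0 1) φ) (h0 : φ 0 = 0) {E : ℕ → Set Ω} {N : ℕ}
    (hE : ∀ k, MeasurableSet (E k)) (hanti : Antitone E) (hE0 : E 0 = univ) (hEN : E N = ∅) :
    ∃ Z : Ω → ℝ, Measurable Z ∧ (∃ C, ∀ ω, |Z ω| ≤ C) ∧
      (∀ A, MeasurableSet A → φ (P.real A) ≤ ∫ ω in A, Z ω ∂P) ∧
      (∀ k, ∫ ω in E k, Z ω ∂P = φ (P.real (E k))) ∧
      (MonotoneOn φ (Icc 0 1) → ∀ ω, 0 ≤ Z ω) ∧ (AntitoneOn φ (Icc 0 1) → ∀ ω, Z ω ≤ 0) := by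
  have hpm : ∀ A : Set Ω, P.real A ∈ Icc (0 : ℝ) 1 := fun A =>
    ⟨measureReal_nonneg, measureReal_le_one⟩
  set D : ℕ → Set Ω := fun k => E k \ E (k + 1) with hD
  have hDm : ∀ k, MeasurableSet (D k) := fun k => (hE k).diff (hE (k + 1))
  set s : ℕ → ℝ := fun k => (φ (P.real (E (k + 1)) + P.real (D k)) - φ (P.real (E (k + 1)))) /
    P.real (D k) with hs
  have hsplit : ∀ A, MeasurableSet A → ∀ k,
      P.real (A ∩ E (k + 1)) + P.real (A ∩ D k) = P.real (A ∩ E k) := by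
    intro A hA k
    rw [← measureReal_union]
    · congr 1
      rw [← inter_union_distrib_left, hD, union_sdiff_cancel (hanti k.le_succ)]
    · exact (disjoint_sdiff_right.mono inter_subset_right inter_subset_right)
    · exact hA.inter (hDm k)
  have hsplit' : ∀ k, P.real (E (k + 1)) + P.real (D k) = P.real (E k) := fun k => by
    simpa using hsplit univ MeasurableSet.univ k
  have hinteg : ∀ k, Integrable ((D k).indicator fun _ => s k) P := fun k =>
    (integrable_const _).indicator (hDm k)
  have hZA : ∀ A, MeasurableSet A →
      ∫ ω in A, ∑ k ∈ Finset.range N, (D k).indicator (fun _ => s k) ω ∂P =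
        ∑ k ∈ Finset.range N, s k * P.real (A ∩ D k) := by
    intro A hA
    rw [integral_finsetSum _ fun k _ => (hinteg k).integrableOn]
    refine Finset.sum_congr rfl fun k _ => ?_
    rw [integral_indicator_const _ (hDm k), measureReal_restrict_apply (hDm k), inter_comm,
      smul_eq_mul, mul_comm]
  have htel : ∀ A, ∑ k ∈ Finset.range N, (φ (P.real (A ∩ E k)) - φ (P.real (A ∩ E (k + 1)))) =
      φ (P.real A) := by
    intro A
    rw [Finset.sum_range_sub', hE0, hEN]
    simp [h0]
  refine ⟨fun ω => ∑ k ∈ Finset.range N, (D k).indicator (fun _ => s k) ω, ?_, ?_, ?_, ?_, ?_, ?_⟩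
  · exact Finset.measurable_fun_sum _ fun k _ => measurable_const.indicator (hDm k)
  · refine ⟨∑ k ∈ Finset.range N, |s k|, fun ω => (Finset.abs_sum_le_sum_abs _ _).trans ?_⟩
    refine Finset.sum_le_sum fun k _ => ?_
    by_cases hω : ω ∈ D k <;> simp [hω]
  · intro A hA
    rw [hZA A hA, ← htel A]
    refine Finset.sum_le_sum fun k _ => ?_
    rw [← hsplit A hA k]
    have hmono : P.real (A ∩ D k) ≤ P.real (D k) := measureReal_mono inter_subset_right
    refine hconv.sub_le_slope_mul (hpm _) ?_ (hpm _) ?_ measureReal_nonneg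
      (measureReal_mono inter_subset_right) ?_ fun hne => ?_
    · rw [hsplit A hA k]; exact hpm _
    · rw [hsplit' k]; exact hpm _
    · rw [hsplit A hA k, hsplit' k]; exact measureReal_mono inter_subset_right
    · exact (measureReal_nonneg.lt_of_ne' hne).trans_le hmono
  · intro j
    rw [hZA _ (hE j), ← htel (E j)]
    refine Finset.sum_congr rfl fun k _ => ?_
    rcases le_or_gt j k with hjk | hjk
    · rw [inter_eq_right.2 (sdiff_subset.trans (hanti hjk) : D k ⊆ E j),
        inter_eq_right.2 (hanti hjk), inter_eq_right.2 (hanti (hjk.trans k.le_succ)), hs]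
      simp only [hsplit' k]
      by_cases hz : P.real (D k) = 0
      · have := hsplit' k
        rw [hz, add_zero] at this
        simp [hz, this]
      · exact div_mul_cancel₀ _ hz
    · have h1 : E j ⊆ E (k + 1) := hanti hjk
      have h2 : E j ∩ D k = ∅ := by
        rw [← disjoint_iff_inter_eq_empty]
        exact disjoint_sdiff_right.mono_left h1
      rw [h2, inter_eq_left.2 h1, inter_eq_left.2 (hanti hjk.le)]
      simp
  · intro hm ω
    refine Finset.sum_nonneg fun k _ => indicator_nonneg (fun _ _ => ?_) ω
    refine div_nonneg (sub_nonneg.2 (hm (hpm _) ?_ ?_)) measureReal_nonneg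
    · rw [hsplit' k]; exact hpm _
    · simp
  · intro hm ω
    refine Finset.sum_nonpos fun k _ => indicator_apply_le' (fun _ => ?_) (fun _ => le_rfl)
    refine div_nonpos_of_nonpos_of_nonneg (sub_nonpos.2 (hm (hpm _) ?_ ?_)) measureReal_nonneg
    · rw [hsplit' k]; exact hpm _
    · simp

/-- Layer-cake formula for a bounded nonnegative random variable against a bounded signed
density. -/
lemma integral_mul_eq_integral_layers (P : Measure Ω) [IsProbabilityMeasure P] {Z X : Ω → ℝ}
    (hZ : Measurable Z) {C : ℝ} (hC : ∀ ω, |Z ω| ≤ C) (hX : Measurable X) (hX0 : ∀ ω, 0 ≤ X ω)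
    {M : ℝ} (hM : ∀ ω, X ω ≤ M) :
    IntegrableOn (fun x => ∫ ω in {ω | x < X ω}, Z ω ∂P) (Ioc 0 M) ∧
    ∫ x in Ioc 0 M, ∫ ω in {ω | x < X ω}, Z ω ∂P = ∫ ω, Z ω * X ω ∂P := by
  have hmeas : MeasurableSet {q : ℝ × Ω | q.1 < X q.2} :=
    measurableSet_lt measurable_fst (hX.comp measurable_snd)
  have hinteg : Integrable (Function.uncurry fun (x : ℝ) (ω : Ω) => {ω | x < X ω}.indicator Z ω)
      ((volume.restrict (Ioc 0 M)).prod P) := by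
    have heq : (Function.uncurry fun (x : ℝ) (ω : Ω) => {ω | x < X ω}.indicator Z ω) =
        {q : ℝ × Ω | q.1 < X q.2}.indicator fun q => Z q.2 := by
      ext ⟨x, ω⟩; rfl
    rw [heq]
    refine Integrable.of_bound
      ((hZ.comp measurable_snd).indicator hmeas).aestronglyMeasurable C (ae_of_all _ fun q => ?_)
    exact (norm_indicator_le_norm_self _ _).trans (hC q.2)
  have hset : ∀ x : ℝ, ∫ ω, {ω | x < X ω}.indicator Z ω ∂P = ∫ ω in {ω | x < X ω}, Z ω ∂P :=
    fun x => integral_indicator (measurableSet_lt measurable_const hX)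
  constructor
  · simpa only [Function.uncurry, hset] using! hinteg.integral_prod_left
  · simp only [← hset]
    rw [integral_integral_swap hinteg]
    refine integral_congr_ae (ae_of_all _ fun ω => ?_)
    have : ∀ x : ℝ, {ω | x < X ω}.indicator Z ω = (Iio (X ω)).indicator (fun _ => Z ω) x := by
      intro x; simp [indicator]
    simp only [this]
    rw [integral_indicator_const _ measurableSet_Iio, measureReal_restrict_apply measurableSet_Iio]
    have hvol : volume.real (Iio (X ω) ∩ Ioc 0 M) = X ω := by
      refine le_antisymm ?_ ?_
      · calc _ ≤ volume.real (Ioc 0 (X ω)) := measureReal_mono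
              (show _ ⊆ Ioc 0 (X ω) from fun x hx => ⟨hx.2.1, le_of_lt hx.1⟩) (by simp)
          _ = X ω := by simp [hX0 ω]
      · calc X ω = volume.real (Ioo 0 (X ω)) := by simp [hX0 ω]
          _ ≤ volume.real (Iio (X ω) ∩ Ioc 0 M) := measureReal_mono
            (fun x hx => ⟨hx.2, hx.1, hx.2.le.trans (hM ω)⟩)
            ((measure_mono inter_subset_right).trans_lt (by simp)).ne
    rw [hvol, smul_eq_mul, mul_comm]

/-- The distortion integral written with strict upper level sets. -/
def layerInt (P : Measure Ω) (φ : ℝ → ℝ) (X : Ω → ℝ) : ℝ :=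
  ∫ x in Ioi (0 : ℝ), φ (P.real {ω | x < X ω})

lemma layerInt_eq_setIntegral_Ioc {P : Measure Ω} {φ : ℝ → ℝ} (h0 : φ 0 = 0) {X : Ω → ℝ} {M : ℝ}
    (hM : ∀ ω, X ω ≤ M) :
    layerInt P φ X = ∫ x in Ioc 0 M, φ (P.real {ω | x < X ω}) := by
  refine setIntegral_eq_of_subset_of_forall_sdiff_eq_zero measurableSet_Ioi Ioc_subset_Ioi_self
    fun x hx => ?_
  have hMx : M < x := by
    by_contra! hle
    exact hx.2 ⟨hx.1, hle⟩
  have : {ω | x < X ω} = ∅ := eq_empty_of_forall_notMem fun ω hω =>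
    absurd (hMx.trans hω) (not_lt.2 (hM ω))
  rw [this, measureReal_empty, h0]

section Monotonicity

variable (P : Measure Ω) [IsProbabilityMeasure P] (X : Ω → ℝ)

lemma measureReal_mem_Icc (A : Set Ω) : P.real A ∈ Icc (0 : ℝ) 1 :=
  ⟨measureReal_nonneg, measureReal_le_one⟩

lemma antitone_survival : Antitone fun x : ℝ => P.real {ω | x < X ω} :=
  fun _ _ hxy => measureReal_mono fun _ hω => lt_of_le_of_lt hxy hω

lemma antitone_distorted_survival {φ : ℝ → ℝ} (hφ : MonotoneOn φ (Icc 0 1)) :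
    Antitone fun x : ℝ => φ (P.real {ω | x < X ω}) := fun _ _ hxy =>
  hφ (measureReal_mem_Icc P _) (measureReal_mem_Icc P _) (antitone_survival P X hxy)

lemma monotone_distorted_survival {φ : ℝ → ℝ} (hφ : AntitoneOn φ (Icc 0 1)) :
    Monotone fun x : ℝ => φ (P.real {ω | x < X ω}) := fun _ _ hxy =>
  hφ (measureReal_mem_Icc P _) (measureReal_mem_Icc P _) (antitone_survival P X hxy)

lemma integrableOn_distorted_survival {φ : ℝ → ℝ}
    (hφ : MonotoneOn φ (Icc 0 1) ∨ AntitoneOn φ (Icc 0 1)) (M : ℝ) :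
    IntegrableOn (fun x : ℝ => φ (P.real {ω | x < X ω})) (Ioc 0 M) := by
  refine IntegrableOn.mono_set ?_ Ioc_subset_Icc_self
  rcases hφ with hφ | hφ
  · exact ((antitone_distorted_survival P X hφ).antitoneOn _).integrableOn_isCompact isCompact_Icc
  · exact ((monotone_distorted_survival P X hφ).monotoneOn _).integrableOn_isCompact isCompact_Icc

end Monotonicity

/-- A convex distortion of `P` is dominated by a bounded density under which the mean of `X` is
arbitrarily close to the distortion integral of `X`. -/
lemma exists_density_integral_mul_le (P : Measure Ω) [IsProbabilityMeasure P] {φ : ℝ → ℝ}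
    (hconv : ConvexOn ℝ (Icc 0 1) φ) (h0 : φ 0 = 0)
    (hmono : MonotoneOn φ (Icc 0 1) ∨ AntitoneOn φ (Icc 0 1))
    {X : Ω → ℝ} (hX : MemLpos X) {ε : ℝ} (hε : 0 < ε) :
    ∃ Z : Ω → ℝ, Measurable Z ∧ (∃ C, ∀ ω, |Z ω| ≤ C) ∧
      (∀ A, MeasurableSet A → φ (P.real A) ≤ ∫ ω in A, Z ω ∂P) ∧
      ∫ ω, Z ω * X ω ∂P ≤ layerInt P φ X + ε := by
  obtain ⟨hXm, hX0, M, hM⟩ := hX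
  have hΩ : Nonempty Ω := nonempty_of_isProbabilityMeasure P
  have hM0 : 0 ≤ M := (hX0 hΩ.some).trans (hM _)
  obtain ⟨δ, hδ, hδε⟩ : ∃ δ : ℝ, 0 < δ ∧ δ * |φ 1| ≤ ε := by
    refine ⟨ε / (|φ 1| + 1), by positivity, ?_⟩
    rw [div_mul_eq_mul_div, div_le_iff₀ (by positivity)]
    nlinarith [abs_nonneg (φ 1)]
  set E : ℕ → Set Ω := fun k => {ω | k * δ - δ < X ω} with hE
  have hEm : ∀ k, MeasurableSet (E k) := fun k => measurableSet_lt measurable_const hXm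
  have hEanti : Antitone E := fun j k hjk ω (hω : k * δ - δ < X ω) => by
    have : (j : ℝ) * δ ≤ k * δ := by gcongr
    show j * δ - δ < X ω
    linarith
  have hE0 : E 0 = univ := eq_univ_of_forall fun ω => by
    show ((0 : ℕ) : ℝ) * δ - δ < X ω
    have := hX0 ω
    push_cast
    linarith
  obtain ⟨N, hN⟩ := exists_nat_ge ((M + δ) / δ)
  rw [div_le_iff₀ hδ] at hN
  have hEN : E N = ∅ := eq_empty_of_forall_notMem fun ω (hω : N * δ - δ < X ω) => by
    have := hM ω
    linarith
  obtain ⟨Z, hZm, ⟨C, hC⟩, hdom, hchain, hZpos, hZneg⟩ :=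
    exists_density_of_chain P hconv h0 hEm hEanti hE0 hEN
  refine ⟨Z, hZm, ⟨C, hC⟩, hdom, le_trans ?_ (add_le_add_right hδε _)⟩
  have hZi : Integrable Z P :=
    Integrable.of_bound hZm.aestronglyMeasurable C (ae_of_all _ hC)
  obtain ⟨hlay_int, hlay⟩ := integral_mul_eq_integral_layers P hZm hC hXm hX0 hM
  rw [← hlay, layerInt_eq_setIntegral_Ioc h0 hM]
  set u : ℝ → ℝ := fun x => φ (P.real {ω | x < X ω}) with hu
  have hgrid : ∀ x : ℝ, 0 < x → ∃ k : ℕ, x ≤ k * δ ∧ k * δ < x + δ := fun x hx => by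
    refine ⟨⌈x / δ⌉₊, ?_, ?_⟩
    · rw [← div_le_iff₀ hδ]; exact Nat.le_ceil _
    · have := Nat.ceil_lt_add_one (div_nonneg hx.le hδ.le)
      rw [← sub_lt_iff_lt_add, lt_div_iff₀ hδ] at this
      linarith
  rw [← intervalIntegral.integral_of_le hM0, ← intervalIntegral.integral_of_le hM0]
  have hlay_int' := (intervalIntegrable_iff_integrableOn_Ioc_of_le hM0).2 hlay_int
  rcases hmono with hφ | hφ
  · have hua : Antitone u := antitone_distorted_survival P X hφ
    have hui : ∀ a b, IntervalIntegrable u volume a b := fun a b => hua.intervalIntegrable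
    have hu1 : ∀ x, u x ≤ φ 1 := fun x =>
      hφ (measureReal_mem_Icc P _) (by simp) measureReal_le_one
    have hu0 : ∀ x, 0 ≤ u x := fun x => by
      rw [← h0]; exact hφ (by simp) (measureReal_mem_Icc P _) measureReal_nonneg
    have hstep : ∫ x in (0 : ℝ)..M, (∫ ω in {ω | x < X ω}, Z ω ∂P) ≤
        ∫ x in (0 : ℝ)..M, u (x - δ) := by
      refine intervalIntegral.integral_mono_on_of_le_Ioo hM0 hlay_int'
        (hua.comp_monotone fun a b hab => sub_le_sub_right hab δ).intervalIntegrable fun x hx => ?_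
      obtain ⟨k, hk1, hk2⟩ := hgrid x hx.1
      calc ∫ ω in {ω | x < X ω}, Z ω ∂P ≤ ∫ ω in E k, Z ω ∂P := by
            refine setIntegral_mono_set hZi.integrableOn (ae_of_all _ (hZpos hφ)) ?_
            refine (show _ ⊆ E k from fun ω (hω : x < X ω) => ?_).eventuallyLE
            show k * δ - δ < X ω
            linarith
        _ = u (k * δ - δ) := hchain k
        _ ≤ u (x - δ) := hua (by linarith)
    refine hstep.trans ?_
    rw [intervalIntegral.integral_comp_sub_right u δ]
    have e1 := intervalIntegral.integral_add_adjacent_intervals (hui (0 - δ) 0) (hui 0 M)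
    have e2 := intervalIntegral.integral_add_adjacent_intervals (hui (0 - δ) (M - δ)) (hui (M - δ) M)
    have e3 : 0 ≤ ∫ x in (M - δ)..M, u x :=
      intervalIntegral.integral_nonneg (by linarith) fun x _ => hu0 x
    have e4 : ∫ x in (0 - δ)..0, u x ≤ δ * |φ 1| := by
      calc ∫ x in (0 - δ)..0, u x ≤ ∫ x in (0 - δ)..0, φ 1 :=
            intervalIntegral.integral_mono (by linarith) (hui _ _) (by simp) hu1
        _ = δ * φ 1 := by simp
        _ ≤ δ * |φ 1| := by gcongr; exact le_abs_self _
    linarith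
  · have hua : Monotone u := monotone_distorted_survival P X hφ
    have hui : ∀ a b, IntervalIntegrable u volume a b := fun a b => hua.intervalIntegrable
    have hu1 : ∀ x, φ 1 ≤ u x := fun x =>
      hφ (measureReal_mem_Icc P _) (by simp) measureReal_le_one
    have hu0 : ∀ x, u x ≤ 0 := fun x => by
      rw [← h0]; exact hφ (by simp) (measureReal_mem_Icc P _) measureReal_nonneg
    have hstep : ∫ x in (0 : ℝ)..M, (∫ ω in {ω | x < X ω}, Z ω ∂P) ≤
        ∫ x in (0 : ℝ)..M, u (x + δ) := by
      refine intervalIntegral.integral_mono_on_of_le_Ioo hM0 hlay_int'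
        (hua.comp fun a b hab => add_le_add_left hab δ).intervalIntegrable fun x hx => ?_
      obtain ⟨k, hk1, hk2⟩ := hgrid x hx.1
      calc ∫ ω in {ω | x < X ω}, Z ω ∂P ≤ ∫ ω in E (k + 1), Z ω ∂P := by
            rw [← neg_le_neg_iff, ← integral_neg, ← integral_neg]
            refine setIntegral_mono_set hZi.neg.integrableOn
              (ae_of_all _ fun ω => neg_nonneg.2 (hZneg hφ ω)) ?_
            refine (show E (k + 1) ⊆ _ from fun ω hω => ?_).eventuallyLE
            have hω : ((k + 1 : ℕ) : ℝ) * δ - δ < X ω := hω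
            push_cast at hω
            show x < X ω
            linarith
        _ = u ((k + 1 : ℕ) * δ - δ) := hchain (k + 1)
        _ ≤ u (x + δ) := hua (by push_cast; linarith)
    refine hstep.trans ?_
    rw [intervalIntegral.integral_comp_add_right u δ]
    have e1 := intervalIntegral.integral_add_adjacent_intervals (hui 0 (0 + δ)) (hui (0 + δ) (M + δ))
    have e2 := intervalIntegral.integral_add_adjacent_intervals (hui 0 M) (hui M (M + δ))
    have e3 : ∫ x in M..(M + δ), u x ≤ 0 := by
      rw [← neg_nonneg, ← intervalIntegral.integral_neg]
      exact intervalIntegral.integral_nonneg (by linarith) fun x _ => neg_nonneg.2 (hu0 x)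
    have e4 : -(δ * |φ 1|) ≤ ∫ x in (0 : ℝ)..(0 + δ), u x := by
      calc -(δ * |φ 1|) ≤ δ * φ 1 := by nlinarith [neg_abs_le (φ 1)]
        _ = ∫ x in (0 : ℝ)..(0 + δ), φ 1 := by simp
        _ ≤ ∫ x in (0 : ℝ)..(0 + δ), u x :=
            intervalIntegral.integral_mono (by linarith) (by simp) (hui _ _) hu1
    linarith

/-- If `g` is dominated by every split of the distortions
`φ i`, the total distortion integral of an allocation of `X` is at least that of `X` under `g`. -/
lemma layerInt_le_sum_layerInt (P : Measure Ω) [IsProbabilityMeasure P] {n : ℕ} (hn : 0 < n)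
    {φ : Fin n → ℝ → ℝ} (hconv : ∀ i, ConvexOn ℝ (Icc 0 1) (φ i)) (h0 : ∀ i, φ i 0 = 0)
    (hmono : ∀ i, MonotoneOn (φ i) (Icc 0 1) ∨ AntitoneOn (φ i) (Icc 0 1)) {g : ℝ → ℝ}
    (hg0 : g 0 = 0)
    (hg : ∀ t : Fin n → ℝ, (∀ i, t i ∈ Icc (0 : ℝ) 1) → ∑ i, t i ∈ Icc (0 : ℝ) 1 →
      g (∑ i, t i) ≤ ∑ i, φ i (t i))
    {X : Ω → ℝ} (hX : MemLpos X)
    (hgi : ∀ M : ℝ, IntegrableOn (fun x : ℝ => g (P.real {ω | x < X ω})) (Ioc 0 M))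
    {Xs : Fin n → Ω → ℝ} (hXs : IsAllocPos P X Xs) :
    layerInt P g X ≤ ∑ i, layerInt P (φ i) (Xs i) := by
  have hne : Nonempty (Fin n) := ⟨⟨0, hn⟩⟩
  refine le_of_forall_pos_le_add fun ε hε => ?_
  have hεn : 0 < ε / n := by positivity
  choose Z hZm hZb hdom hZX using fun i =>
    exists_density_integral_mul_le P (hconv i) (h0 i) (hmono i) (hXs.1 i) hεn
  choose C hC using hZb
  obtain ⟨hXm, hX0, M, hM⟩ := hX
  set W : Ω → ℝ := fun ω => ⨅ i, Z i ω with hW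
  have hWm : Measurable W := Measurable.iInf hZm
  have hWle : ∀ i ω, W ω ≤ Z i ω := fun i ω => ciInf_le (finite_range _).bddBelow i
  have hWeq : ∀ ω, ∃ i, W ω = Z i ω := fun ω => by
    obtain ⟨i, hi⟩ := exists_eq_ciInf_of_finite (f := fun i => Z i ω)
    exact ⟨i, hi.symm⟩
  have hWb : ∀ ω, |W ω| ≤ ∑ i, |C i| := fun ω => by
    obtain ⟨i, hi⟩ := hWeq ω
    rw [hi]
    exact ((hC i ω).trans (le_abs_self _)).trans
      (Finset.single_le_sum (f := fun i => |C i|) (fun _ _ => abs_nonneg _) (Finset.mem_univ i))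
  have hWi : Integrable W P := Integrable.of_bound hWm.aestronglyMeasurable _ (ae_of_all _ hWb)
  have hWA : ∀ A, MeasurableSet A → g (P.real A) ≤ ∫ ω in A, W ω ∂P := by
    intro A hA
    set B := disjointed fun i => {ω | W ω = Z i ω} with hB
    have hBm : ∀ i, MeasurableSet (B i) := fun i => by
      rw [hB, disjointed_eq_inter_compl]
      refine (measurableSet_eq_fun hWm (hZm i)).inter ?_
      exact MeasurableSet.biInter (to_countable _) fun j _ =>
        (measurableSet_eq_fun hWm (hZm j)).compl
    have hBd : Pairwise (Function.onFun Disjoint fun i => A ∩ B i) := fun i j hij =>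
      (disjoint_disjointed _ hij).mono inter_subset_right inter_subset_right
    have hBu : ⋃ i, A ∩ B i = A := by
      rw [← inter_iUnion, hB, iUnion_disjointed]
      refine inter_eq_left.2 fun ω _ => mem_iUnion.2 (hWeq ω)
    have hPA : ∑ i, P.real (A ∩ B i) = P.real A := by
      rw [← measureReal_iUnion_fintype hBd fun i => hA.inter (hBm i), hBu]
    calc g (P.real A) = g (∑ i, P.real (A ∩ B i)) := by rw [hPA]
      _ ≤ ∑ i, φ i (P.real (A ∩ B i)) :=
          hg _ (fun i => measureReal_mem_Icc P _) (by rw [hPA]; exact measureReal_mem_Icc P _)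
      _ ≤ ∑ i, ∫ ω in A ∩ B i, Z i ω ∂P :=
          Finset.sum_le_sum fun i _ => hdom i _ (hA.inter (hBm i))
      _ = ∑ i, ∫ ω in A ∩ B i, W ω ∂P := by
          refine Finset.sum_congr rfl fun i _ => ?_
          refine setIntegral_congr_fun (hA.inter (hBm i)) fun ω hω => ?_
          exact (disjointed_subset (fun i => {ω | W ω = Z i ω}) i hω.2 : W ω = Z i ω).symm
      _ = ∫ ω in A, W ω ∂P := by
          rw [← integral_iUnion_fintype (fun i => hA.inter (hBm i)) hBd
            (fun i => hWi.integrableOn), hBu]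
  obtain ⟨hlay_int, hlay⟩ := integral_mul_eq_integral_layers P hWm hWb hXm hX0 hM
  have hprod : ∀ (V : Ω → ℝ) (c : ℝ), Measurable V → (∀ ω, |V ω| ≤ c) → ∀ i,
      Integrable (fun ω => V ω * Xs i ω) P := by
    intro V c hV hVc i
    obtain ⟨him, hi0, m, hm⟩ := hXs.1 i
    refine (Integrable.of_bound him.aestronglyMeasurable m (ae_of_all _ fun ω => ?_)).bdd_mul
      hV.aestronglyMeasurable (ae_of_all _ hVc)
    rw [Real.norm_of_nonneg (hi0 ω)]; exact hm ω
  calc layerInt P g X = ∫ x in Ioc 0 M, g (P.real {ω | x < X ω}) :=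
        layerInt_eq_setIntegral_Ioc hg0 hM
    _ ≤ ∫ x in Ioc 0 M, ∫ ω in {ω | x < X ω}, W ω ∂P :=
        integral_mono (hgi M) hlay_int fun x => hWA _ (measurableSet_lt measurable_const hXm)
    _ = ∫ ω, W ω * X ω ∂P := hlay
    _ = ∫ ω, ∑ i, W ω * Xs i ω ∂P := by
        refine integral_congr_ae ?_
        filter_upwards [hXs.2] with ω hω
        rw [← Finset.mul_sum, hω]
    _ = ∑ i, ∫ ω, W ω * Xs i ω ∂P :=
        integral_finsetSum _ fun i _ => hprod W _ hWm hWb i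
    _ ≤ ∑ i, ∫ ω, Z i ω * Xs i ω ∂P :=
        Finset.sum_le_sum fun i _ => integral_mono (hprod W _ hWm hWb i)
          (hprod (Z i) _ (hZm i) (hC i) i)
          fun ω => mul_le_mul_of_nonneg_right (hWle i ω) ((hXs.1 i).2.1 ω)
    _ ≤ ∑ i, (layerInt P (φ i) (Xs i) + ε / n) := Finset.sum_le_sum fun i _ => hZX i
    _ = ∑ i, layerInt P (φ i) (Xs i) + ε := by
        rw [Finset.sum_add_distrib, Finset.sum_const, Finset.card_univ, Fintype.card_fin,
          nsmul_eq_mul, mul_div_cancel₀ _ (by positivity)]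

/-- A finite decomposition of the law of `X` is realized by a measurable partition of the sample
space, given a uniform random variable independent of `X`. -/
lemma exists_partition_of_sum_eq_map (P : Measure Ω) [IsProbabilityMeasure P] {n : ℕ}
    {X U : Ω → ℝ} (hX : Measurable X) (hU : Measurable U)
    (hUunif : Measure.map U P = volume.restrict (Icc (0 : ℝ) 1)) (hindep : IndepFun U X P)
    {m : Fin n → Measure ℝ} (hm : ∑ i, m i = P.map X) :
    ∃ A : Fin n → Set Ω, (∀ i, MeasurableSet (A i)) ∧ Pairwise (Function.onFun Disjoint A) ∧
      (∀ᵐ ω ∂P, ∃ i, ω ∈ A i) ∧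
      ∀ i B, MeasurableSet B → P (A i ∩ X ⁻¹' B) = m i B := by
  set μ := P.map X with hμ
  have : IsProbabilityMeasure μ := Measure.isProbabilityMeasure_map hX.aemeasurable
  have hle : ∀ i, m i ≤ μ := fun i => by
    rw [← hm]
    exact Finset.single_le_sum (f := m) (fun _ _ => Measure.zero_le _) (Finset.mem_univ i)
  have hfin : ∀ i, IsFiniteMeasure (m i) := fun i => isFiniteMeasure_of_le μ (hle i)
  set w : Fin n → ℝ → ENNReal := fun i => (m i).rnDeriv μ with hw
  have hwm : ∀ i, Measurable (w i) := fun i => Measure.measurable_rnDeriv _ _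
  have hwd : ∀ i, μ.withDensity (w i) = m i := fun i =>
    Measure.withDensity_rnDeriv_eq _ _ (hle i).absolutelyContinuous
  have hwsum : ∀ᵐ y ∂μ, ∑ i, w i y = 1 := by
    have h1 : μ.withDensity (fun y => ∑ i, w i y) = μ.withDensity 1 := by
      ext B hB
      rw [withDensity_one, withDensity_apply _ hB, lintegral_finsetSum _ fun i _ => hwm i]
      conv_rhs => rw [← hm]
      rw [Measure.finsetSum_apply]
      exact Finset.sum_congr rfl fun i _ => by rw [← withDensity_apply _ hB, hwd i]
    have h2 := (withDensity_eq_iff (Finset.measurable_fun_sum _ fun i _ => hwm i).aemeasurable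
      aemeasurable_const (by
        rw [← setLIntegral_univ, ← withDensity_apply _ MeasurableSet.univ, h1, withDensity_one]
        simp)).1 h1
    exact h2
  set v : Fin n → ℝ → ℝ := fun i y => (w i y).toReal with hv
  have hvm : ∀ i, Measurable (v i) := fun i => (hwm i).ennreal_toReal
  have hv0 : ∀ i y, 0 ≤ v i y := fun i y => ENNReal.toReal_nonneg
  set c : Fin n → ℝ → ℝ := fun i y => ∑ j ∈ Finset.Iio i, v j y with hc
  have hcm : ∀ i, Measurable (c i) := fun i => Finset.measurable_fun_sum _ fun j _ => hvm j
  have hc0 : ∀ i y, 0 ≤ c i y := fun i y => Finset.sum_nonneg fun j _ => hv0 j y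
  have hcv : ∀ i y, c i y + v i y = ∑ j ∈ Finset.Iic i, v j y := fun i y => by
    rw [← Finset.Iio_insert, Finset.sum_insert (by simp), add_comm]
  set A : Fin n → Set Ω := fun i => {ω | c i (X ω) ≤ U ω ∧ U ω < c i (X ω) + v i (X ω)} with hA
  have hAm : ∀ i, MeasurableSet (A i) := fun i =>
    (measurableSet_le ((hcm i).comp hX) hU).inter
      (measurableSet_lt hU (((hcm i).comp hX).add ((hvm i).comp hX)))
  have hdisj : ∀ i j, i < j → Disjoint (A i) (A j) := fun i j hij => by
    refine Set.disjoint_left.2 fun ω hi hj => ?_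
    have : c i (X ω) + v i (X ω) ≤ c j (X ω) := by
      rw [hcv]
      refine Finset.sum_le_sum_of_subset_of_nonneg (fun k hk => ?_) fun k _ _ => hv0 k _
      rw [Finset.mem_Iic] at hk
      exact Finset.mem_Iio.2 (hk.trans_lt hij)
    exact absurd (hi.2.trans_le this) (not_lt.2 hj.1)
  have hpair : Pairwise (Function.onFun Disjoint A) := fun i j hij => by
    rcases lt_or_gt_of_ne hij with h | h
    · exact hdisj i j h
    · exact (hdisj j i h).symm
  have hlaw : ∀ i B, MeasurableSet B → P (A i ∩ X ⁻¹' B) = m i B := by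
    intro i B hB
    set S : Set (ℝ × ℝ) := {q | (c i q.2 ≤ q.1 ∧ q.1 < c i q.2 + v i q.2) ∧ q.2 ∈ B} with hS
    have hSm : MeasurableSet S := by
      refine ((measurableSet_le ((hcm i).comp measurable_snd) measurable_fst).inter
        (measurableSet_lt measurable_fst (((hcm i).comp measurable_snd).add
          ((hvm i).comp measurable_snd)))).inter (measurable_snd hB)
    have hpre : A i ∩ X ⁻¹' B = (fun ω => (U ω, X ω)) ⁻¹' S := rfl
    rw [hpre, ← Measure.map_apply (hU.prodMk hX) hSm,
      (indepFun_iff_map_prod_eq_prod_map_map hU.aemeasurable hX.aemeasurable).1 hindep, hUunif,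
      Measure.prod_apply_symm hSm, ← hwd i, withDensity_apply _ hB, ← lintegral_indicator hB]
    refine lintegral_congr_ae ?_
    filter_upwards [hwsum] with y hy
    by_cases hyB : y ∈ B
    · have hpre' : (fun u : ℝ => (u, y)) ⁻¹' S = Ico (c i y) (c i y + v i y) := by
        ext u; simp [hS, hyB]
      have hfinw : ∀ j, w j y ≠ ⊤ := fun j hj => by
        have := Finset.single_le_sum (f := fun j => w j y) (fun _ _ => zero_le)
          (Finset.mem_univ j)
        rw [hy] at this
        simp [hj] at this
      have hle1 : c i y + v i y ≤ 1 := by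
        have htot : ∑ j, v j y = 1 := by
          rw [hv, ← ENNReal.toReal_sum fun j _ => hfinw j, hy, ENNReal.toReal_one]
        rw [hcv, ← htot]
        exact Finset.sum_le_sum_of_subset_of_nonneg (Finset.subset_univ _) fun k _ _ => hv0 k y
      have hsub : Ico (c i y) (c i y + v i y) ⊆ Icc 0 1 := fun u hu =>
        ⟨(hc0 i y).trans hu.1, hu.2.le.trans hle1⟩
      rw [hpre', Measure.restrict_apply measurableSet_Ico, inter_eq_left.2 hsub, Real.volume_Ico,
        indicator_of_mem hyB, add_sub_cancel_left, hv, ENNReal.ofReal_toReal (hfinw i)]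
    · have hpre' : (fun u : ℝ => (u, y)) ⁻¹' S = ∅ := by
        ext u; simp [hS, hyB]
      rw [hpre', measure_empty, indicator_of_notMem hyB]
  refine ⟨A, hAm, hpair, ?_, hlaw⟩
  have hfull : P (⋃ i, A i) = 1 := by
    have h1 : ∀ i, P (A i) = m i univ := fun i => by simpa using hlaw i univ MeasurableSet.univ
    rw [measure_iUnion hpair hAm, tsum_fintype]
    simp only [h1]
    rw [← Measure.finsetSum_apply, hm, measure_univ]
  have hae := (prob_compl_eq_zero_iff (MeasurableSet.iUnion hAm)).2 hfull
  filter_upwards [mem_ae_iff.2 hae] with ω hω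
  exact mem_iUnion.1 hω

/-- Monotone shares of the identity are continuous. -/
lemma continuousOn_of_monotoneOn_of_sum_eq {n : ℕ} {t : Fin n → ℝ → ℝ}
    (hmono : ∀ i, MonotoneOn (t i) (Icc 0 1)) (hsum : ∀ p ∈ Icc (0 : ℝ) 1, ∑ i, t i p = p)
    (i : Fin n) : ContinuousOn (t i) (Icc 0 1) := by
  have hle : ∀ p ∈ Icc (0 : ℝ) 1, ∀ q ∈ Icc (0 : ℝ) 1, p ≤ q → t i q - t i p ≤ q - p := by
    intro p hp q hq hpq
    calc t i q - t i p ≤ ∑ j, (t j q - t j p) :=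
          Finset.single_le_sum (f := fun j => t j q - t j p)
            (fun j _ => sub_nonneg.2 (hmono j hp hq hpq)) (Finset.mem_univ i)
      _ = q - p := by rw [Finset.sum_sub_distrib, hsum p hp, hsum q hq]
  refine (LipschitzOnWith.of_le_add_mul 1 fun p hp q hq => ?_).continuousOn
  rw [NNReal.coe_one, one_mul, Real.dist_eq]
  rcases le_total p q with hpq | hpq
  · have := hmono i hp hq hpq
    linarith [abs_nonneg (p - q)]
  · have := hle q hq p hp hpq
    rw [abs_of_nonneg (sub_nonneg.2 hpq)]
    linarith

/-- Monotone shares of the survival function of `X` are realized by a measurable partition of the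
sample space. -/
lemma exists_partition_survival (P : Measure Ω) [IsProbabilityMeasure P] {n : ℕ}
    {X U : Ω → ℝ} (hX : Measurable X) (hU : Measurable U)
    (hUunif : Measure.map U P = volume.restrict (Icc (0 : ℝ) 1)) (hindep : IndepFun U X P)
    {t : Fin n → ℝ → ℝ} (hmono : ∀ i, MonotoneOn (t i) (Icc 0 1)) (ht0 : ∀ i, t i 0 = 0)
    (hsum : ∀ p ∈ Icc (0 : ℝ) 1, ∑ i, t i p = p) :
    ∃ A : Fin n → Set Ω, (∀ i, MeasurableSet (A i)) ∧ Pairwise (Function.onFun Disjoint A) ∧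
      (∀ᵐ ω ∂P, ∃ i, ω ∈ A i) ∧
      ∀ i (x : ℝ), P.real (A i ∩ {ω | x < X ω}) = t i (P.real {ω | x < X ω}) := by
  set μ := P.map X with hμ
  have : IsProbabilityMeasure μ := Measure.isProbabilityMeasure_map hX.aemeasurable
  have hcdf : ∀ x, 1 - cdf μ x ∈ Icc (0 : ℝ) 1 := fun x =>
    ⟨sub_nonneg.2 (cdf_le_one μ x), sub_le_self _ (cdf_nonneg μ x)⟩
  have hcdf_eq : ∀ x, 1 - cdf μ x = P.real {ω | x < X ω} := fun x => by
    rw [cdf_eq_real, ← probReal_compl_eq_one_sub measurableSet_Iic, compl_Iic, hμ,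
      map_measureReal_apply hX measurableSet_Ioi]
    rfl
  have hcont := continuousOn_of_monotoneOn_of_sum_eq hmono hsum
  let F : Fin n → StieltjesFunction ℝ := fun i =>
    { toFun := fun x => t i 1 - t i (1 - cdf μ x)
      mono' := fun x y hxy => sub_le_sub_left
        (hmono i (hcdf y) (hcdf x) (sub_le_sub_left (monotone_cdf μ hxy) 1)) _
      right_continuous' := fun x => continuousWithinAt_const.sub
        (ContinuousWithinAt.comp (f := fun y => 1 - cdf μ y) (hcont i _ (hcdf x))
          (continuousWithinAt_const.sub ((cdf μ).right_continuous x)) fun y _ => hcdf y) }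
  have hF : ∀ i x, F i x = t i 1 - t i (1 - cdf μ x) := fun i x => rfl
  have hFtop : ∀ i, Filter.Tendsto (F i) Filter.atTop (nhds (t i 1 - t i 0)) := fun i => by
    refine tendsto_const_nhds.sub ?_
    refine (hcont i 0 (by simp)).tendsto.comp (tendsto_nhdsWithin_iff.2 ⟨?_, .of_forall hcdf⟩)
    simpa using (tendsto_cdf_atTop μ).const_sub 1
  have hsumm : ∑ i, (F i).measure = μ := by
    have hfin : ∀ i, IsFiniteMeasure (F i).measure := fun i => by
      refine (F i).isFiniteMeasure_of_forall_abs_le (C := |t i 1|) fun x => ?_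
      have h1 := hmono i (hcdf x) (by simp) (hcdf x).2
      have h2 := hmono i (by simp) (hcdf x) (hcdf x).1
      rw [ht0] at h2
      rw [hF, abs_of_nonneg (sub_nonneg.2 h1)]
      exact (sub_le_self _ h2).trans (le_abs_self _)
    refine Measure.ext_of_Ioc _ _ fun a b hab => ?_
    conv_rhs => rw [← measure_cdf μ]
    rw [Measure.finsetSum_apply, StieltjesFunction.measure_Ioc]
    simp only [StieltjesFunction.measure_Ioc]
    rw [← ENNReal.ofReal_sum_of_nonneg fun i _ => sub_nonneg.2 ((F i).mono hab.le)]
    congr 1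
    simp only [hF, sub_sub_sub_cancel_left]
    rw [Finset.sum_sub_distrib, hsum _ (hcdf _), hsum _ (hcdf _)]
    ring
  obtain ⟨A, hAm, hpair, hcover, hlaw⟩ :=
    exists_partition_of_sum_eq_map P hX hU hUunif hindep hsumm
  refine ⟨A, hAm, hpair, hcover, fun i x => ?_⟩
  have hpos : 0 ≤ t i (1 - cdf μ x) := by
    rw [← ht0 i]; exact hmono i (by simp) (hcdf x) (hcdf x).1
  have := hlaw i (Ioi x) measurableSet_Ioi
  rw [(F i).measure_Ioi (hFtop i), hF, ht0, sub_zero, sub_sub_cancel] at this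
  rw [← hcdf_eq, measureReal_def]
  exact (congrArg ENNReal.toReal this).trans (ENNReal.toReal_ofReal hpos)

/-- The inf-convolution of convex distortion integrals over nonnegative allocations is the
distortion integral of the inf-convolved distortion, attained by a counter-monotonic allocation. -/
lemma layerInt_funInfConv_isLeast (P : Measure Ω) [IsProbabilityMeasure P] {n : ℕ} (hn : 0 < n)
    {φ : Fin n → ℝ → ℝ} (hconv : ∀ i, ConvexOn ℝ (Icc 0 1) (φ i))
    (hcont : ∀ i, ContinuousOn (φ i) (Icc 0 1)) (h0 : ∀ i, φ i 0 = 0)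
    (hmono : ∀ i, MonotoneOn (φ i) (Icc 0 1) ∨ AntitoneOn (φ i) (Icc 0 1))
    {X U : Ω → ℝ} (hX : MemLpos X) (hU : Measurable U)
    (hUunif : Measure.map U P = volume.restrict (Icc (0 : ℝ) 1)) (hindep : IndepFun U X P) :
    funInfConv φ 0 = 0 ∧
    (∃ Xs : Fin n → Ω → ℝ, IsAllocPos P X Xs ∧ PairwiseCtr P Xs ∧
      ∑ i, layerInt P (φ i) (Xs i) = layerInt P (funInfConv φ) X) ∧
    ∀ Xs : Fin n → Ω → ℝ, IsAllocPos P X Xs →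
      layerInt P (funInfConv φ) X ≤ ∑ i, layerInt P (φ i) (Xs i) := by
  obtain ⟨t, htmono, ht⟩ := exists_monotone_minimizer hn hconv hcont
  have hleast : ∀ p ∈ Icc (0 : ℝ) 1, IsLeast {y : ℝ | ∃ t : Fin n → ℝ,
      (∀ i, t i ∈ Icc (0 : ℝ) 1) ∧ (∑ i, t i) = p ∧ y = ∑ i, φ i (t i)} (∑ i, φ i (t i p)) := by
    refine fun p hp => ⟨⟨fun i => t i p, (ht p hp).1, (ht p hp).2.1, rfl⟩, ?_⟩
    rintro _ ⟨s, hs, hsp, rfl⟩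
    exact (ht p hp).2.2 s hs hsp
  have hg : ∀ p ∈ Icc (0 : ℝ) 1, funInfConv φ p = ∑ i, φ i (t i p) := fun p hp =>
    (hleast p hp).csInf_eq
  have ht0 : ∀ i, t i 0 = 0 := fun i => by
    have h := ht 0 (by simp)
    exact (Finset.sum_eq_zero_iff_of_nonneg fun j _ => (h.1 j).1).1 h.2.1 i (Finset.mem_univ i)
  have hg0 : funInfConv φ 0 = 0 := by
    rw [hg 0 (by simp)]
    simp [ht0, h0]
  obtain ⟨hXm, hX0, M, hM⟩ := hX
  obtain ⟨A, hAm, hpair, hcover, hlaw⟩ :=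
    exists_partition_survival P hXm hU hUunif hindep htmono ht0 fun p hp => (ht p hp).2.1
  have hlevel : ∀ i (x : ℝ), 0 < x →
      P.real {ω | x < (A i).indicator X ω} = t i (P.real {ω | x < X ω}) := by
    intro i x hx
    rw [← hlaw i x]
    congr 1
    ext ω
    by_cases hω : ω ∈ A i <;> simp [hω, hx.le]
  have hbound : ∀ i ω, (A i).indicator X ω ≤ M := fun i ω =>
    (indicator_le_self' (fun _ _ => hX0 _) ω).trans (hM ω)
  have hinteg : ∀ i (M : ℝ),
      IntegrableOn (fun x : ℝ => φ i (t i (P.real {ω | x < X ω}))) (Ioc 0 M) := fun i M =>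
    (integrableOn_distorted_survival P ((A i).indicator X) (hmono i) M).congr_fun
      (fun x hx => by simp only [hlevel i x hx.1]) measurableSet_Ioc
  have hgX : ∀ x : ℝ, funInfConv φ (P.real {ω | x < X ω}) =
      ∑ i, φ i (t i (P.real {ω | x < X ω})) := fun x => hg _ (measureReal_mem_Icc P _)
  refine ⟨hg0, ⟨fun i => (A i).indicator X, ⟨fun i => ?_, ?_⟩, ?_, ?_⟩, fun Xs hXs => ?_⟩
  · exact ⟨hXm.indicator (hAm i), indicator_nonneg fun ω _ => hX0 ω, M, hbound i⟩
  · filter_upwards [hcover] with ω ⟨i, hi⟩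
    rw [Finset.sum_eq_single i (fun j _ hji => indicator_of_notMem
      (Set.disjoint_right.1 (hpair hji) hi) X) (by simp), indicator_of_mem hi]
  · refine fun i j hij => ae_of_all _ fun q => ?_
    have hd : ∀ ω, ω ∈ A i → ω ∉ A j := fun ω hω => Set.disjoint_left.1 (hpair hij) hω
    have h1 := hX0 q.1
    have h2 := hX0 q.2
    by_cases hi1 : q.1 ∈ A i <;> by_cases hi2 : q.2 ∈ A i
    · simp [hd _ hi1, hd _ hi2]
    · by_cases hj2 : q.2 ∈ A j
      · simp [hd _ hi1, hi1, hi2, hj2, mul_nonneg h1 h2]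
      · simp [hd _ hi1, hj2]
    · by_cases hj1 : q.1 ∈ A j
      · simp [hd _ hi2, hi1, hi2, hj1, mul_nonneg h2 h1]
      · simp [hd _ hi2, hj1]
    · simp [hi1, hi2]
  · rw [layerInt_eq_setIntegral_Ioc hg0 hM]
    simp only [hgX]
    rw [integral_finsetSum _ fun i _ => hinteg i M]
    refine Finset.sum_congr rfl fun i _ => ?_
    rw [layerInt_eq_setIntegral_Ioc (h0 i) (hbound i)]
    exact setIntegral_congr_fun measurableSet_Ioc fun x hx => by simp only [hlevel i x hx.1]
  · refine layerInt_le_sum_layerInt P hn hconv h0 hmono hg0 (fun s hs hsum => ?_)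
      ⟨hXm, hX0, M, hM⟩ (fun M => ?_) hXs
    · rw [hg _ hsum]
      exact (ht _ hsum).2.2 s hs rfl
    · simp only [hgX]
      exact integrable_finsetSum _ fun i _ => hinteg i M

lemma distortionPos_eq_layerInt (P : Measure Ω) [IsProbabilityMeasure P] (g : ℝ → ℝ) (X : Ω → ℝ) :
    distortionPos P g X = layerInt P g X := by
  refine integral_congr_ae (ae_restrict_of_ae ?_)
  filter_upwards [meas_le_ae_eq_meas_lt P volume X] with x hx
  rw [hx]
  rfl

lemma distortionNeg_eq_layerInt (P : Measure Ω) [IsProbabilityMeasure P] (g : ℝ → ℝ) {X : Ω → ℝ}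
    (hX : Measurable X) :
    distortionNeg P g X = layerInt P (fun p => g (1 - p) - g 1) (fun ω => -X ω) := by
  have hlevel : ∀ y : ℝ, (P {ω | -y ≤ X ω}).toReal = 1 - P.real {ω | y < -X ω} := fun y => by
    have hm : MeasurableSet {ω | y < -X ω} := measurableSet_lt measurable_const hX.neg
    rw [← probReal_compl_eq_one_sub hm, measureReal_def]
    congr 2
    ext ω
    simp [neg_le]
  rw [distortionNeg, ← integral_Iic_eq_integral_Iio]
  have := integral_comp_neg_Ioi (0 : ℝ) fun x => g ((P {ω | x ≤ X ω}).toReal) - g 1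
  rw [neg_zero] at this
  rw [← this, layerInt]
  simp only [hlevel]

/-- Sup-convolution is the negative of the inf-convolution of the negatives. -/
lemma funSupConv_eq_neg_funInfConv {n : ℕ} (l : Fin n → ℝ → ℝ) (x : ℝ) :
    funSupConv l x = -funInfConv (fun i t => -l i t) x := by
  rw [funSupConv, funInfConv, ← Real.sSup_neg]
  congr 1
  ext y
  simp only [mem_ofPred_eq, Set.mem_neg, Finset.sum_neg_distrib, neg_inj]

lemma isAllocPos_neg_iff {P : Measure Ω} {n : ℕ} {X : Ω → ℝ} {Xs : Fin n → Ω → ℝ} :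
    IsAllocPos P (fun ω => -X ω) (fun i ω => -Xs i ω) ↔ IsAllocNeg P X Xs := by
  have hmeas : ∀ Y : Ω → ℝ, (Measurable fun ω => -Y ω) ↔ Measurable Y := fun Y => measurable_neg_iff
  simp only [IsAllocPos, IsAllocNeg, MemLpos, MemLneg, Left.nonneg_neg_iff, hmeas,
    Finset.sum_neg_distrib, neg_inj, neg_le]

lemma pairwiseCtr_neg_iff {P : Measure Ω} {n : ℕ} {Xs : Fin n → Ω → ℝ} :
    PairwiseCtr P (fun i ω => -Xs i ω) ↔ PairwiseCtr P Xs := by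
  have : ∀ a b c d : ℝ, (-a - -b) * (-c - -d) = (a - b) * (c - d) := fun a b c d => by ring
  simp only [PairwiseCtr, CounterMonotone, this]

/-- If the infimum of a real-valued objective over `S` is attained inside `T ⊆ S`, then the
extended-real infima over `S` and `T` agree with the attained value. -/
lemma sInf_coe_eq_of_attained {α : Type*} {S T : α → Prop} {f : α → ℝ} {r : ℝ}
    (hattain : ∃ a, S a ∧ T a ∧ f a = r) (hle : ∀ a, S a → r ≤ f a) :
    sInf {y : EReal | ∃ a, S a ∧ y = (f a : EReal)} =
      sInf {y : EReal | ∃ a, S a ∧ T a ∧ y = (f a : EReal)} ∧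
    sInf {y : EReal | ∃ a, S a ∧ T a ∧ y = (f a : EReal)} = (r : EReal) := by
  obtain ⟨a, hS, hT, rfl⟩ := hattain
  have h1 : IsLeast {y : EReal | ∃ a, S a ∧ y = (f a : EReal)} (f a) := by
    refine ⟨⟨a, hS, rfl⟩, ?_⟩
    rintro _ ⟨b, hb, rfl⟩
    exact EReal.coe_le_coe_iff.2 (hle b hb)
  have h2 : IsLeast {y : EReal | ∃ a, S a ∧ T a ∧ y = (f a : EReal)} (f a) := by
    refine ⟨⟨a, hS, hT, rfl⟩, ?_⟩
    rintro _ ⟨b, hb, -, rfl⟩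
    exact EReal.coe_le_coe_iff.2 (hle b hb)
  rw [h1.csInf_eq, h2.csInf_eq]
  exact ⟨rfl, rfl⟩

/-- Lemma 3. Suppose each `h_i ∈ H` is convex, continuous on `[0,1]`, and
twice continuously differentiable on `(0,1)`, and `X` admits an independent uniform random
variable. (i) If `X ∈ L^+` then `□ ρ_{h_i}(X) = ⊟ ρ_{h_i}(X) = ρ_g(X)` with `g = □ h_i`.
(ii) If `X ∈ L^−` then the same holds with `g(x) = (◊ h̃_i)(1) − (◊ h̃_i)(1−x)`,
`h̃_i(t) = 1 − h_i(1−t)`. -/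
theorem infConv_convex_smooth
    (P : Measure Ω) [IsProbabilityMeasure P] (hP : Atomless P)
    {n : ℕ} (hn : 0 < n)
    (h : Fin n → ℝ → ℝ) (hH : ∀ i, MemH (h i))
    (hconv : ∀ i, ConvexOn ℝ (Icc 0 1) (h i))
    (hcont : ∀ i, ContinuousOn (h i) (Icc 0 1))
    (hC2 : ∀ i, ContDiffOn ℝ 2 (h i) (Ioo 0 1))
    (X : Ω → ℝ)
    (U : Ω → ℝ) (hU : Measurable U)
    (hUunif : Measure.map U P = volume.restrict (Icc (0:ℝ) 1))
    (hindep : IndepFun U X P) :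
    (MemLpos X →
      infConvPos P h X = ctrInfConvPos P h X ∧
      ctrInfConvPos P h X = ((distortionPos P (funInfConv h) X : ℝ) : EReal)) ∧
    (MemLneg X →
      infConvNeg P h X = ctrInfConvNeg P h X ∧
      ctrInfConvNeg P h X =
        ((distortionNeg P (fun x => funSupConv (fun i t => 1 - h i (1 - t)) 1 -
          funSupConv (fun i t => 1 - h i (1 - t)) (1 - x)) X : ℝ) : EReal)) := by
  constructor
  · intro hX
    obtain ⟨-, ⟨Xs, hXs, hctr, heq⟩, hle⟩ := layerInt_funInfConv_isLeast P hn hconv hcont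
      (fun i => (hH i).2.1) (fun i => Or.inl (hH i).1) hX hU hUunif hindep
    simp only [infConvPos, ctrInfConvPos, distortionPos_eq_layerInt]
    exact sInf_coe_eq_of_attained ⟨Xs, hXs, hctr, heq⟩ hle
  · intro hX
    have hflip : MapsTo (fun p : ℝ => 1 - p) (Icc 0 1) (Icc 0 1) := fun p hp =>
      ⟨sub_nonneg.2 hp.2, sub_le_self _ hp.1⟩
    set φ : Fin n → ℝ → ℝ := fun i t => -(1 - h i (1 - t)) with hφ
    have hφconv : ∀ i, ConvexOn ℝ (Icc 0 1) (φ i) := fun i => by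
      refine ⟨convex_Icc 0 1, fun x hx y hy a b ha hb hab => ?_⟩
      have := (hconv i).2 (hflip hx) (hflip hy) ha hb hab
      simp only [smul_eq_mul] at this ⊢
      rw [show a * (1 - x) + b * (1 - y) = 1 - (a * x + b * y) by linear_combination hab] at this
      simp only [hφ]
      linear_combination this + hab
    have hφcont : ∀ i, ContinuousOn (φ i) (Icc 0 1) := fun i =>
      (continuousOn_const.sub
        ((hcont i).comp (continuousOn_const.sub continuousOn_id) hflip)).neg
    have hφ0 : ∀ i, φ i 0 = 0 := fun i => by simp [hφ, (hH i).2.2]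
    have hφanti : ∀ i, AntitoneOn (φ i) (Icc 0 1) := fun i x hx y hy hxy => by
      have := (hH i).1 (hflip hy) (hflip hx) (sub_le_sub_left hxy 1)
      simp only [hφ]
      linarith
    have hXneg : MemLpos fun ω => -X ω := by
      obtain ⟨hXm, hX0, M, hM⟩ := hX
      exact ⟨hXm.neg, fun ω => neg_nonneg.2 (hX0 ω), M, fun ω => neg_le.1 (hM ω)⟩
    obtain ⟨hg0, ⟨Xs, hXs, hctr, heq⟩, hle⟩ := layerInt_funInfConv_isLeast P hn hφconv hφcont
      hφ0 (fun i => Or.inr (hφanti i)) hXneg hU hUunif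
      (hindep.comp measurable_id measurable_neg)
    have hrhs : distortionNeg P (fun x => funSupConv (fun i t => 1 - h i (1 - t)) 1 -
        funSupConv (fun i t => 1 - h i (1 - t)) (1 - x)) X =
        layerInt P (funInfConv φ) fun ω => -X ω := by
      rw [distortionNeg_eq_layerInt P _ hX.1]
      congr 1
      ext p
      simp only [funSupConv_eq_neg_funInfConv, sub_self, sub_sub_cancel]
      linear_combination -hg0
    have hlhs : ∀ Ys : Fin n → Ω → ℝ, IsAllocNeg P X Ys →
        ∑ i, distortionNeg P (h i) (Ys i) = ∑ i, layerInt P (φ i) fun ω => -Ys i ω := by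
      refine fun Ys hYs => Finset.sum_congr rfl fun i _ => ?_
      rw [distortionNeg_eq_layerInt P _ (hYs.1 i).1]
      congr 1
      ext p
      simp only [hφ, (hH i).2.2]
      ring
    rw [hrhs]
    have hXs' : IsAllocNeg P X fun i ω => -Xs i ω :=
      isAllocPos_neg_iff.1 (by simpa only [neg_neg] using hXs)
    refine sInf_coe_eq_of_attained ⟨fun i ω => -Xs i ω, hXs', pairwiseCtr_neg_iff.2 hctr, ?_⟩
      fun Ys hYs => ?_
    · rw [hlhs _ hXs', ← heq]
      simp only [neg_neg]
    · rw [hlhs _ hYs]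
      exact hle _ (isAllocPos_neg_iff.2 hYs)
end
end
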